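/- arXiv:2512.18059 — 5 statements merged into one kernel-verified Lean document; each statement's English description precedes it below -/
import Mathlib

section
/- Let d ≥ 2, m ∈ ℕ, A ∈ ℝ^{m×d} with columns a₁, …, a_d ∈ ℝ^m, and b ∈ ℝ^m. Define Û₁(x₁) = (x₁a₁ + b, a₂, …, a_d) ∈ ℝ^{m×d}, Ûₖ(xₖ) = I_d + (xₖ − 1)eₖeₖᵀ = diag(1, …, 1, xₖ, 1, …, 1) ∈ ℝ^{d×d} (with xₖ in position k) for 2 ≤ k ≤ d−1, and Û_d(x_d) = (1, …, 1, x_d)ᵀ ∈ ℝ^{d×1}. Then for all x ∈ ℝ^d, Û₁(x₁)·Û₂(x₂)⋯Û_d(x_d) = A x + b. In particular, the affine map x ↦ Ax + b admits a tensor-train representation with affine factors and ranks at most d. -/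
noncomputable def ttProdAux {d : ℕ} (r : Fin (d + 1) → ℕ)
    (U : ∀ i : Fin d, Matrix (Fin (r i.castSucc)) (Fin (r i.succ)) ℝ) :
    ∀ k : Fin (d + 1), Matrix (Fin (r 0)) (Fin (r k)) ℝ :=
  Fin.induction (motive := fun k => Matrix (Fin (r 0)) (Fin (r k)) ℝ) 1
    fun i acc => acc * U i

noncomputable def ttProd {d : ℕ} (r : Fin (d + 1) → ℕ)
    (U : ∀ i : Fin d, Matrix (Fin (r i.castSucc)) (Fin (r i.succ)) ℝ) :
    Matrix (Fin (r 0)) (Fin (r (Fin.last d))) ℝ :=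
  ttProdAux r U (Fin.last d)

def AffineEntry (f : ℝ → ℝ) : Prop := ∃ a b : ℝ, ∀ t, f t = a * t + b

def AffineFactor {m n : ℕ} (U : ℝ → Matrix (Fin m) (Fin n) ℝ) : Prop :=
  ∀ i j, AffineEntry fun t => U t i j

/-- The product of the first factor `(x₀ a₀ + b, a₁, …)`, the diagonal factors and the last factor
`(1, …, 1, x_{d-1})ᵀ` collapses to `A x + b`. -/
lemma sum_affine_factors_eq {d m : ℕ} (hd : 2 ≤ d) (hpos : 0 < d)
    (A : Matrix (Fin m) (Fin d) ℝ) (b : Fin m → ℝ) (x : Fin d → ℝ) (i : Fin m) :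
    ∑ l : Fin d, (if l = (⟨0, hpos⟩ : Fin d) then x ⟨0, hpos⟩ * A i ⟨0, hpos⟩ + b i
          else A i l) * (if 1 ≤ (l : ℕ) ∧ (l : ℕ) < d - 1 then x l else 1) *
        (if (l : ℕ) = d - 1 then x l else 1) = A.mulVec x i + b i := by
  have key : ∀ l : Fin d,
      (if l = (⟨0, hpos⟩ : Fin d) then x ⟨0, hpos⟩ * A i ⟨0, hpos⟩ + b i
          else A i l) * (if 1 ≤ (l : ℕ) ∧ (l : ℕ) < d - 1 then x l else 1) *
        (if (l : ℕ) = d - 1 then x l else 1)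
      = A i l * x l + if l = (⟨0, hpos⟩ : Fin d) then b i else 0 := by
    intro l
    by_cases h0 : l = (⟨0, hpos⟩ : Fin d)
    · subst h0
      have : ¬ (0 = d - 1) := by omega
      simp [this, mul_comm]
    · have h1 : 1 ≤ (l : ℕ) := by
        have : (l : ℕ) ≠ 0 := fun h => h0 (Fin.ext h)
        omega
      by_cases h2 : (l : ℕ) = d - 1
      · simp only [h0, h2, if_true, if_false, lt_irrefl, and_false, mul_one, add_zero]
      · have : (l : ℕ) < d - 1 := by omega
        simp [h0, h1, h2, this]
  simp_rw [key, Finset.sum_add_distrib]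
  simp [Matrix.mulVec, dotProduct]

/-- The product of the middle diagonal factors. -/
lemma prod_middle_factors {d : ℕ} (ht : ∀ t : Fin (d - 2), (t : ℕ) + 1 < d) (x : Fin d → ℝ) :
    ((List.finRange (d - 2)).map (fun (t : Fin (d - 2)) =>
          Matrix.diagonal fun l : Fin d =>
            if l = (⟨(t : ℕ) + 1, ht t⟩ : Fin d)
            then x ⟨(t : ℕ) + 1, ht t⟩ else 1)).prod
      = Matrix.diagonal fun l : Fin d =>
          if 1 ≤ (l : ℕ) ∧ (l : ℕ) < d - 1 then x l else 1 := by
  have h := map_list_prod (Matrix.diagonalRingHom (Fin d) ℝ)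
    ((List.finRange (d - 2)).map (fun (t : Fin (d - 2)) => fun l : Fin d =>
            if l = (⟨(t : ℕ) + 1, ht t⟩ : Fin d)
            then x ⟨(t : ℕ) + 1, ht t⟩ else 1))
  rw [List.map_map] at h
  refine h.symm.trans (congrArg Matrix.diagonal ?_)
  rw [← List.ofFn_eq_map, List.prod_ofFn]
  ext l
  rw [Finset.prod_apply]
  split_ifs with hl
  · rw [Finset.prod_eq_single (⟨l - 1, by omega⟩ : Fin (d - 2))]
    · have : (⟨(l : ℕ) - 1 + 1, by omega⟩ : Fin d) = l := Fin.ext (by simp; omega)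
      simp [this]
    · intro t _ hne
      refine if_neg fun h => hne (Fin.ext ?_)
      simp [h]
    · simp
  · refine Finset.prod_eq_one fun t _ => if_neg fun h => hl ?_
    have h' := congrArg Fin.val h
    have := t.isLt
    simp only at h'
    omega

/-- The ranks `(m, d, …, d, 1)`. -/
def affineRank (d m : ℕ) (k : Fin (d + 1)) : ℕ :=
  if (k : ℕ) = 0 then m else if (k : ℕ) = d then 1 else d

lemma affineRank_of_pos_of_lt {d m : ℕ} {k : Fin (d + 1)} (h0 : (k : ℕ) ≠ 0) (hk : (k : ℕ) ≠ d) :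
    affineRank d m k = d := by simp [affineRank, h0, hk]

/-- The tensor-train factors of `x ↦ A x + b`; indices out of range give the entry `0`. -/
noncomputable def affineTTFactor {d m : ℕ} (A : Matrix (Fin m) (Fin d) ℝ) (b : Fin m → ℝ)
    (i : Fin d) (t : ℝ) :
    Matrix (Fin (affineRank d m i.castSucc)) (Fin (affineRank d m i.succ)) ℝ :=
  Matrix.of fun p q =>
    if (i : ℕ) = 0 then
      if h : (p : ℕ) < m ∧ (q : ℕ) < d then
        if (q : ℕ) = 0 then t * A ⟨p, h.1⟩ ⟨q, h.2⟩ + b ⟨p, h.1⟩ else A ⟨p, h.1⟩ ⟨q, h.2⟩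
      else 0
    else if (i : ℕ) = d - 1 then if (p : ℕ) = d - 1 then t else 1
    else if (p : ℕ) = q then if (p : ℕ) = i then t else 1 else 0

lemma affineFactor_affineTTFactor {d m : ℕ} (A : Matrix (Fin m) (Fin d) ℝ) (b : Fin m → ℝ)
    (i : Fin d) : AffineFactor (affineTTFactor A b i) := by
  have hc : ∀ c : ℝ, AffineEntry fun _ => c := fun c => ⟨0, c, fun t => by ring⟩
  have hid : AffineEntry fun t => t := ⟨1, 0, fun t => by ring⟩
  intro p q
  simp only [affineTTFactor, Matrix.of_apply]
  split_ifs
  · exact ⟨_, _, fun t => congrArg (· + _) (mul_comm _ _)⟩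
  all_goals first | exact hc _ | exact hid

lemma ttProdAux_succ {d : ℕ} (r : Fin (d + 1) → ℕ)
    (U : ∀ i : Fin d, Matrix (Fin (r i.castSucc)) (Fin (r i.succ)) ℝ) (i : Fin d) :
    ttProdAux r U i.succ = ttProdAux r U i.castSucc * U i := by
  simp [ttProdAux]

lemma ttProdAux_first {d : ℕ} (hd : 0 < d) (r : Fin (d + 1) → ℕ)
    (U : ∀ i : Fin d, Matrix (Fin (r i.castSucc)) (Fin (r i.succ)) ℝ) :
    ttProdAux r U (⟨0, hd⟩ : Fin d).succ = U ⟨0, hd⟩ := by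
  rw [ttProdAux_succ]
  exact Matrix.one_mul (U ⟨0, hd⟩)

/-- The partial products of the tensor train before the last factor. -/
lemma ttProdAux_affineTTFactor {d m : ℕ} (A : Matrix (Fin m) (Fin d) ℝ) (b : Fin m → ℝ)
    (x : Fin d → ℝ) (n : ℕ) (hn : n + 1 < d) (p : Fin (affineRank d m 0))
    (q : Fin (affineRank d m (⟨n, by omega⟩ : Fin d).succ)) (hp : (p : ℕ) < m) (hq : (q : ℕ) < d) :
    ttProdAux (affineRank d m) (fun k => affineTTFactor A b k (x k)) (⟨n, by omega⟩ : Fin d).succ p q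
      = (if (⟨q, hq⟩ : Fin d) = ⟨0, by omega⟩
          then x ⟨0, by omega⟩ * A ⟨p, hp⟩ ⟨0, by omega⟩ + b ⟨p, hp⟩ else A ⟨p, hp⟩ ⟨q, hq⟩) *
        (if 1 ≤ (q : ℕ) ∧ (q : ℕ) < n + 1 then x ⟨q, hq⟩ else 1) := by
  induction n with
  | zero =>
    have h2 : ¬ (1 ≤ (q : ℕ) ∧ (q : ℕ) < 0 + 1) := by omega
    rw [if_neg h2, mul_one]
    refine (congrFun (congrFun (ttProdAux_first (by omega) (affineRank d m)
      (fun k => affineTTFactor A b k (x k))) p) q).trans ((dif_pos ⟨hp, hq⟩).trans ?_)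
    by_cases h : (q : ℕ) = 0
    · simp [h]
    · simp [h]
  | succ n ih =>
    have hr : affineRank d m (⟨n + 1, by omega⟩ : Fin d).castSucc = d :=
      affineRank_of_pos_of_lt (by simp) (by simp; omega)
    have hU : ∀ l : Fin (affineRank d m (⟨n + 1, by omega⟩ : Fin d).castSucc),
        affineTTFactor A b (⟨n + 1, by omega⟩ : Fin d) (x ⟨n + 1, by omega⟩) l q
        = if (l : ℕ) = q then if (l : ℕ) = n + 1 then x ⟨n + 1, by omega⟩ else 1 else 0 := by
      intro l
      have : ¬ (n + 1 = d - 1) := by omega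
      simp [affineTTFactor, this]
    rw [ttProdAux_succ, Matrix.mul_apply,
      Finset.sum_eq_single (⟨q, by rw [hr]; exact hq⟩ :
        Fin (affineRank d m (⟨n + 1, by omega⟩ : Fin d).castSucc))]
    · rw [hU]
      refine (congrArg (· * _) (ih (by omega) ⟨q, by
        have : affineRank d m (⟨n, by omega⟩ : Fin d).succ = d := hr
        omega⟩ hq)).trans ?_
      simp only [if_true]
      rw [mul_assoc]
      congr 1
      by_cases h : (q : ℕ) = n + 1
      · simp [h]
      · have : (q : ℕ) < n + 1 + 1 ↔ (q : ℕ) < n + 1 := by omega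
        simp [h, this]
    · intro l _ hl
      rw [hU, if_neg (fun h => hl (Fin.ext h)), mul_zero]
    · simp

lemma ttProd_affineTTFactor {d m : ℕ} (hd : 2 ≤ d) (A : Matrix (Fin m) (Fin d) ℝ) (b : Fin m → ℝ)
    (x : Fin d → ℝ) (p : Fin (affineRank d m 0)) (q : Fin (affineRank d m (Fin.last d)))
    (hp : (p : ℕ) < m) :
    ttProd (affineRank d m) (fun k => affineTTFactor A b k (x k)) p q
      = A.mulVec x ⟨p, hp⟩ + b ⟨p, hp⟩ := by
  obtain ⟨n, rfl⟩ : ∃ n, d = n + 2 := ⟨d - 2, by omega⟩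
  have hr : affineRank (n + 2) m (⟨n + 1, by omega⟩ : Fin (n + 2)).castSucc = n + 2 :=
    affineRank_of_pos_of_lt (by simp) (by simp)
  rw [← sum_affine_factors_eq hd (by omega)]
  refine (congrFun (congrFun (ttProdAux_succ (affineRank (n + 2) m)
    (fun k => affineTTFactor A b k (x k)) (⟨n + 1, by omega⟩ : Fin (n + 2))) p) q).trans ?_
  rw [Matrix.mul_apply]
  refine Fintype.sum_equiv (finCongr hr) _ _ fun l => ?_
  have hl : (l : ℕ) < n + 2 := lt_of_lt_of_eq l.isLt hr
  have e : finCongr hr l = ⟨l, hl⟩ := rfl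
  rw [e]
  refine congrArg₂ (· * ·) (ttProdAux_affineTTFactor A b x n (by omega) p l hp hl) ?_
  by_cases h : (l : ℕ) = n + 1
  · simp [affineTTFactor, h]
  · simp [affineTTFactor, h]

/-- The explicit TT factors Û₁(x₁) = (x₁a₁+b, a₂, …, a_d),
Ûₖ(xₖ) = diag(1,…,xₖ,…,1), Û_d(x_d) = (1,…,1,x_d)ᵀ multiply to Ax + b; in
particular, x ↦ Ax + b admits a TT representation with affine factors and
ranks at most d. -/
theorem stmt_4 (d m : ℕ) (hd : 2 ≤ d)
    (A : Matrix (Fin m) (Fin d) ℝ) (b : Fin m → ℝ) :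
    (∀ x : Fin d → ℝ, ∀ i : Fin m,
      ((Matrix.of fun (i : Fin m) (j : Fin d) =>
          if j = (⟨0, by omega⟩ : Fin d) then x ⟨0, by omega⟩ * A i ⟨0, by omega⟩ + b i
          else A i j) *
        ((List.finRange (d - 2)).map (fun (t : Fin (d - 2)) =>
          Matrix.diagonal fun l : Fin d =>
            if l = (⟨(t : ℕ) + 1, by have := t.isLt; omega⟩ : Fin d)
            then x ⟨(t : ℕ) + 1, by have := t.isLt; omega⟩ else 1)).prod *
        Matrix.of fun (l : Fin d) (_ : Fin 1) =>
          if (l : ℕ) = d - 1 then x l else 1) i 0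
      = A.mulVec x i + b i) ∧
    ∃ (r : Fin (d + 1) → ℕ) (h0 : r 0 = m),
      r (Fin.last d) = 1 ∧
      (∀ k : Fin (d + 1), k ≠ 0 → k ≠ Fin.last d → r k ≤ d) ∧
      ∃ U : ∀ i : Fin d, ℝ → Matrix (Fin (r i.castSucc)) (Fin (r i.succ)) ℝ,
        (∀ i, AffineFactor (U i)) ∧
        ∀ x : Fin d → ℝ, ∀ (i : Fin (r 0)) (j : Fin (r (Fin.last d))),
          ttProd r (fun k => U k (x k)) i j = A.mulVec x (Fin.cast h0 i) + b (Fin.cast h0 i) := by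
  refine ⟨fun x i => ?_, affineRank d m, by simp [affineRank], ?_, ?_, affineTTFactor A b,
    affineFactor_affineTTFactor A b, fun x i j => ttProd_affineTTFactor hd A b x i j _⟩
  · rw [prod_middle_factors, Matrix.mul_apply, ← sum_affine_factors_eq hd (by omega)]
    simp only [Matrix.mul_diagonal, Matrix.of_apply]
  · have : d ≠ 0 := by omega
    simp [affineRank, this]
  · intro k h0 hk
    exact (affineRank_of_pos_of_lt (fun h => h0 (Fin.ext h)) (fun h => hk (Fin.ext h))).le
end

section
/- Let d ∈ ℕ and a₀, a₁, …, a_d ∈ ℝ, and let g : ℝ → ℝ be the polynomial g(x) = a₀ + a₁x + ⋯ + a_d x^d. Define 𝔏 : ℝ → ℝ², 𝔏(x) = (0, x); 𝔑 : ℝ² → ℝ, 𝔑(x, y) = x; f₁ : ℝ² → ℝ², f₁(x, y) = (a_d, 0); and fₖ : ℝ² → ℝ², fₖ(x, y) = (a_{d−k+1} + x(y − 1), 0) for 2 ≤ k ≤ d+1. Then for all x ∈ ℝ, 𝔑 ∘ (Id + f_{d+1}) ∘ ⋯ ∘ (Id + f₁) ∘ 𝔏(x) = g(x). Hence every univariate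 polynomial of degree d can be represented exactly by a compositional tensor with d+1 layers, width 2, and univariate basis Φ = {1, Id}. -/
/-- Layers acting on the states they meet as `(u, y) ↦ (c k + u * y, y)` evaluate, starting from
`(0, x)`, the polynomial with coefficients `c`, leading coefficient first, at `x`. -/
theorem foldl_finRange_horner {R : Type*} [CommSemiring R] (x : R) (n : ℕ) (c : Fin n → R)
    (f : Fin n → R × R → R × R)
    (hf : ∀ (k : Fin n) (s : R × R), ((k : ℕ) = 0 → s.1 = 0) → s + f k s = (c k + s.1 * s.2, s.2)) :
    (List.finRange n).foldl (fun s k => s + f k s) (0, x) =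
      (∑ k : Fin n, c k * x ^ (k.rev : ℕ), x) := by
  induction n with
  | zero => simp
  | succ n ih =>
    have ih' := ih (fun k => c k.castSucc) (fun k => f k.castSucc)
      (fun k s hs => hf k.castSucc s (by simpa using hs))
    rw [List.finRange_succ_last, List.foldl_append, List.foldl_map, ih', List.foldl_cons,
      List.foldl_nil, hf]
    · refine Prod.ext ?_ rfl
      simp only [Fin.sum_univ_castSucc, Finset.sum_mul, Fin.rev_last, Fin.rev_castSucc,
        Fin.val_succ, pow_succ, mul_assoc]
      simp [add_comm]
    · intro hn
      obtain rfl : n = 0 := by simpa using hn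
      simp

/-- Horner's scheme as a compositional tensor: with lift 𝔏(x) = (0, x),
retraction 𝔑(x, y) = x, and the layers f₁(x,y) = (a_d, 0),
fₖ(x,y) = (a_{d-k+1} + x(y-1), 0), the composition 𝔑 ∘ (Id+f_{d+1}) ∘ ⋯ ∘ (Id+f₁) ∘ 𝔏
equals the polynomial g(x) = a₀ + a₁x + ⋯ + a_d x^d. -/
theorem stmt_6 (d : ℕ) (a : Fin (d + 1) → ℝ) (g : ℝ → ℝ)
    (hg : ∀ x, g x = ∑ i : Fin (d + 1), a i * x ^ (i : ℕ))
    (f : Fin (d + 1) → ℝ × ℝ → ℝ × ℝ)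
    (hf0 : f 0 = fun _ => (a ⟨d, by omega⟩, 0))
    (hfk : ∀ k : Fin (d + 1), k ≠ 0 →
      f k = fun s => (a ⟨d - (k : ℕ), by omega⟩ + s.1 * (s.2 - 1), 0)) :
    ∀ x : ℝ,
      ((List.finRange (d + 1)).foldl (fun s k => s + f k s) ((0 : ℝ), x)).1 = g x := by
  intro x
  rw [foldl_finRange_horner x (d + 1) (fun k => a k.rev) f, hg]
  · exact Equiv.sum_comp Fin.revPerm fun i : Fin (d + 1) => a i * x ^ (i : ℕ)
  · intro k s hs
    by_cases hk : k = 0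
    · subst hk
      rw [hf0]
      ext
      · simp [hs rfl, Fin.rev_zero, Fin.last]
      · simp
    · have hrev : (⟨d - (k : ℕ), by omega⟩ : Fin (d + 1)) = k.rev := by
        ext
        simp [Fin.val_rev]
      rw [hfk k hk, hrev]
      ext
      · simp only [Prod.fst_add]
        ring
      · simp
end

section
/- Let P(x₁, …, x_d) = Σ_{α∈Λ} C_α x^α be a multivariate polynomial, where Λ ⊂ ℕ^d is a finite nonempty set of multi-indices, C_α ∈ ℝ \ {0}, and x^α = Π_{j=1}^d xⱼ^{αⱼ}. Let N_max = max{αⱼ : α ∈ Λ, 1 ≤ j ≤ d}, let q ≥ 2 be the number of workspace slots, and set p = d + 2 + q. Then there exist L ∈ ℕ with L ≤ |Λ|(2 + d + d·⌊log_q(N_max + 1)⌋) and functions ψ₁, …, ψ_L : ℝ^p → ℝ^p, each admitting a tensor-train representation with affine factors and ranks bounded by (p, 2, 2, …, 2, 1), such that with the lift 𝔏(x) = (0, x₁, …, x_d, 0, …, 0) ∈ ℝ^p and the retraction 𝔑(y) = y₁, one has P = 𝔑 ∘ (Id + ψ_L) ∘ ⋯ ∘ (Id + ψ₁) ∘ 𝔏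 on ℝ^d. -/
/-- ψ : ℝ^p → ℝ^p has a TT representation with affine factors, first rank p, last
rank 1 and internal ranks bounded by bnd. -/
def HasTTAffine (p : ℕ) (ψ : (Fin p → ℝ) → Fin p → ℝ) (bnd : ℕ) : Prop :=
  ∃ (r : Fin (p + 1) → ℕ) (h0 : r 0 = p),
    r (Fin.last p) = 1 ∧
    (∀ k : Fin (p + 1), k ≠ 0 → k ≠ Fin.last p → r k ≤ bnd) ∧
    ∃ U : ∀ i : Fin p, ℝ → Matrix (Fin (r i.castSucc)) (Fin (r i.succ)) ℝ,
      (∀ i, AffineFactor (U i)) ∧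
      ∀ y : Fin p → ℝ, ∀ (i : Fin (r 0)) (j : Fin (r (Fin.last p))),
        ttProd r (fun k => U k (y k)) i j = ψ y (Fin.cast h0 i)

section CompositionalTensorTrain

open Finset Polynomial

/-- Coordinates of a finite vector, indexed by natural numbers and extended by zero. -/
def coordOrZero {p : ℕ} (y : Fin p → ℝ) (k : ℕ) : ℝ := if h : k < p then y ⟨k, h⟩ else 0

def AffineMatrix (M : ℝ → Matrix (Fin 2) (Fin 2) ℝ) : Prop :=
  ∀ a b, AffineEntry fun t => M t a b

theorem affineEntry_const (c : ℝ) : AffineEntry fun _ => c := ⟨0, c, fun t => by ring⟩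

theorem affineEntry_id : AffineEntry fun t => t := ⟨1, 0, fun t => by ring⟩

theorem AffineEntry.add {f g : ℝ → ℝ} (hf : AffineEntry f) (hg : AffineEntry g) :
    AffineEntry fun t => f t + g t := by
  obtain ⟨a, b, h⟩ := hf
  obtain ⟨a', b', h'⟩ := hg
  exact ⟨a + a', b + b', fun t => by simp only [h, h']; ring⟩

theorem AffineEntry.mul_const {f : ℝ → ℝ} (hf : AffineEntry f) (c : ℝ) :
    AffineEntry fun t => f t * c := by
  obtain ⟨a, b, h⟩ := hf
  exact ⟨a * c, b * c, fun t => by simp only [h]; ring⟩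

theorem ttProdAux_apply {p : ℕ} (r : Fin (p + 1) → ℕ)
    (U : ∀ i : Fin p, Matrix (Fin (r i.castSucc)) (Fin (r i.succ)) ℝ)
    (G P : ℕ → ℕ → ℕ → ℝ) (hU : ∀ i a b, U i a b = G i a b)
    (h0 : ∀ a b, P 0 a b = if a = b then 1 else 0)
    (hs : ∀ (i : Fin p) (a b : ℕ),
      P (i + 1) a b = ∑ c ∈ range (r i.castSucc), P i a c * G i c b)
    (k : Fin (p + 1)) (a : Fin (r 0)) (b : Fin (r k)) :
    ttProdAux r U k a b = P k a b := by
  induction k using Fin.induction with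
  | zero =>
    have : ttProdAux r U 0 = 1 := rfl
    rw [this, Fin.val_zero, h0, Matrix.one_apply]
    simp [Fin.ext_iff]
  | succ i ih =>
    have : ttProdAux r U i.succ = ttProdAux r U i.castSucc * U i := by
      simp [ttProdAux, Fin.induction_succ]
    rw [this, Matrix.mul_apply, Fin.val_succ, hs,
      ← Fin.sum_univ_eq_sum_range (fun c => P i a c * G i c b)]
    exact Finset.sum_congr rfl fun c _ => by rw [ih, hU]; rfl

/-- A product of affine `2 × 2` factors, preceded by an affine row for each output
coordinate, is a tensor train with internal ranks `2`. -/
theorem hasTTAffine_of_prod {p m : ℕ} (hp : p = m + 2)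
    (row : Fin p → ℝ → Fin 2 → ℝ) (hrow : ∀ i b, AffineEntry fun t => row i t b)
    (M : ℕ → ℝ → Matrix (Fin 2) (Fin 2) ℝ) (hM : ∀ k, AffineMatrix (M k)) (c : Fin 2 → ℝ) :
    HasTTAffine p (fun y i => row i (coordOrZero y 0) ⬝ᵥ
      (((List.range (m + 1)).map fun k => M k (coordOrZero y (k + 1))).prod.mulVec c)) 2 := by
  subst hp
  let r : Fin (m + 2 + 1) → ℕ :=
    fun k => if (k : ℕ) = 0 then m + 2 else if (k : ℕ) = m + 2 then 1 else 2
  let G : ℕ → ℝ → ℕ → ℕ → ℝ := fun i t a b =>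
    if i = 0 then row (Fin.ofNat (m + 2) a) t (Fin.ofNat 2 b)
    else if i = m + 1 then (M m t).mulVec c (Fin.ofNat 2 a)
    else M (i - 1) t (Fin.ofNat 2 a) (Fin.ofNat 2 b)
  have hG : ∀ i a b, AffineEntry fun t => G i t a b := by
    intro i a b
    simp only [G]
    split_ifs
    · exact hrow _ _
    · simp only [Matrix.mulVec, dotProduct, Fin.sum_univ_two]
      exact ((hM _ _ _).mul_const _).add ((hM _ _ _).mul_const _)
    · exact hM _ _ _
  refine ⟨r, rfl, by simp [r], ?_, fun i t => Matrix.of fun a b => G i t a b,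
    fun i a b => hG i a b, ?_⟩
  · intro k h0 h1
    have h0' : (k : ℕ) ≠ 0 := fun h => h0 (Fin.ext h)
    have h1' : (k : ℕ) ≠ m + 2 := fun h => h1 (Fin.ext h)
    simp only [r, if_neg h0', if_neg h1', le_refl]
  intro y i j
  let rn : ℕ → ℕ := fun k => if k = 0 then m + 2 else if k = m + 2 then 1 else 2
  let P : ℕ → ℕ → ℕ → ℝ := fun k => Nat.rec (fun a b => if a = b then 1 else 0)
    (fun k Q a b => ∑ e ∈ range (rn k), Q a e * G k (coordOrZero y k) e b) k
  have hP : ∀ k a b, P (k + 1) a b =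
      ∑ e ∈ range (rn k), P k a e * G k (coordOrZero y k) e b := fun _ _ _ => rfl
  have key := ttProdAux_apply r (fun k => Matrix.of fun a b => G k (y k) a b)
    (fun k => G k (coordOrZero y k)) P
    (fun k a b => by simp [coordOrZero]) (fun _ _ => rfl) (fun k a b => hP k a b)
    (Fin.last _) i j
  rw [ttProd, key]
  set I : Fin (m + 2) := Fin.cast rfl i
  have hi : (i : ℕ) = (I : ℕ) := rfl
  have hj : (j : ℕ) = 0 := by
    have := j.2
    simp only [r, Fin.val_last] at this
    simpa using this
  rw [hi, hj, Fin.val_last]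
  have hP1 : ∀ b, P 1 I b = row I (coordOrZero y 0) (Fin.ofNat 2 b) := by
    intro b
    refine (hP 0 I b).trans ?_
    simp only [rn, if_true, P, G]
    rw [Finset.sum_eq_single (I : ℕ)]
    · simp
    · intro e _ he
      simp [Ne.symm he]
    · intro h
      exact absurd (Finset.mem_range.2 I.2) h
  have hrec : ∀ k, k ≤ m → ∀ b, P (k + 1) I b = Matrix.vecMul (row I (coordOrZero y 0))
      ((List.range k).map fun k => M k (coordOrZero y (k + 1))).prod (Fin.ofNat 2 b) := by
    intro k
    induction k with
    | zero => intro _ b; simpa using hP1 b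
    | succ k ih =>
      intro hk b
      have h1 : rn (k + 1) = 2 := by
        rw [show rn (k + 1) = if k + 1 = 0 then m + 2 else if k + 1 = m + 2 then 1 else 2 from rfl,
          if_neg (by lia), if_neg (by lia)]
      have h2 : ∀ a b, G (k + 1) (coordOrZero y (k + 1)) a b =
          M k (coordOrZero y (k + 1)) (Fin.ofNat 2 a) (Fin.ofNat 2 b) := by
        intro a b
        simp only [G]
        rw [if_neg (by omega), if_neg (by omega)]
        simp
      rw [hP, h1, List.range_succ, List.map_append, List.prod_append, ← Matrix.vecMul_vecMul]
      simp only [Finset.sum_range_succ, Finset.sum_range_zero, zero_add, h2,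
        ih (by omega), List.map_cons, List.map_nil, List.prod_singleton]
      exact (Fin.sum_univ_two (fun a => Matrix.vecMul (row I (coordOrZero y 0))
        ((List.range k).map fun k => M k (coordOrZero y (k + 1))).prod a *
          M k (coordOrZero y (k + 1)) a (Fin.ofNat 2 b))).symm
  have h1 : rn (m + 1) = 2 := by simp [rn]
  have h2 : ∀ a b, G (m + 1) (coordOrZero y (m + 1)) a b =
      (M m (coordOrZero y (m + 1))).mulVec c (Fin.ofNat 2 a) := by
    intro a b
    simp [G]
  change _ = row I (coordOrZero y 0) ⬝ᵥ
    (((List.range (m + 1)).map fun k => M k (coordOrZero y (k + 1))).prod.mulVec c)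
  rw [hP, h1, List.range_succ, List.map_append, List.prod_append, ← Matrix.mulVec_mulVec,
    Matrix.dotProduct_mulVec]
  simp only [Finset.sum_range_succ, Finset.sum_range_zero, zero_add, h2, hrec m le_rfl,
    List.map_cons, List.map_nil, List.prod_singleton]
  rw [dotProduct, Fin.sum_univ_two]
  rfl

theorem list_prod_diagonal (φ : ℕ → Fin 2 → ℝ) (k : ℕ) :
    ((List.range k).map fun i => Matrix.diagonal (φ i)).prod =
      Matrix.diagonal fun a => ∏ i ∈ range k, φ i a := by
  induction k with
  | zero => simp
  | succ k ih =>
    rw [List.range_succ, List.map_append, List.prod_append, ih]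
    simp [Finset.prod_range_succ, Matrix.diagonal_mul_diagonal]

/-- Any two real polynomials of degree at most `n + 1`, one of them of degree at most `n`,
can be written as affine combinations of two polynomials of degree at most `n`. -/
theorem exists_affine_descent (n : ℕ) (u v : ℝ[X]) (hu : u.natDegree ≤ n)
    (hv : v.natDegree ≤ n + 1) : ∃ (u' v' : ℝ[X]) (μ lam ρ : ℝ),
      u'.natDegree ≤ n ∧ v'.natDegree ≤ n ∧
      u = C μ * u' ∧ v = C lam * u' + (X - C ρ) * v' := by
  obtain ⟨u', μ, ρ, hu', hμ, hρ⟩ : ∃ (u' : ℝ[X]) (μ ρ : ℝ),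
      u'.natDegree ≤ n ∧ u = C μ * u' ∧ u'.eval ρ ≠ 0 := by
    by_cases h : u = 0
    · exact ⟨1, 0, 0, by simp, by simp [h], by simp⟩
    · obtain ⟨ρ, hρ⟩ : ∃ ρ, u.eval ρ ≠ 0 := by
        by_contra! hc
        exact h (Polynomial.funext fun t => by simpa using hc t)
      exact ⟨u, 1, ρ, hu, by simp, hρ⟩
  obtain ⟨v', hv'⟩ : (X - C ρ) ∣ v - C (v.eval ρ / u'.eval ρ) * u' := by
    rw [Polynomial.dvd_iff_isRoot]
    simp [hρ]
  refine ⟨u', v', μ, v.eval ρ / u'.eval ρ, ρ, hu', ?_, hμ, by rw [← hv']; ring⟩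
  by_cases h0 : v' = 0
  · simp [h0]
  have h1 : (v - C (v.eval ρ / u'.eval ρ) * u').natDegree ≤ n + 1 := by
    refine (natDegree_sub_le _ _).trans (max_le hv ?_)
    exact (natDegree_C_mul_le _ _).trans (by omega)
  rw [hv', natDegree_mul (X_sub_C_ne_zero ρ) h0, natDegree_X_sub_C] at h1
  omega

/-- Any pair of real polynomials of degree at most `n` is the diagonal restriction of a product
of `n` affine `2 × 2` factors. -/
theorem exists_affine_factorization (n : ℕ) : ∀ f g : ℝ[X], f.natDegree ≤ n → g.natDegree ≤ n →
    ∃ (N : ℕ → ℝ → Matrix (Fin 2) (Fin 2) ℝ) (c : Fin 2 → ℝ), (∀ k, AffineMatrix (N k)) ∧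
      ∀ s, ((List.range n).map fun k => N k s).prod.mulVec c = ![f.eval s, g.eval s] := by
  induction n with
  | zero =>
    intro f g hf hg
    rw [Polynomial.eq_C_of_natDegree_le_zero hf, Polynomial.eq_C_of_natDegree_le_zero hg]
    exact ⟨fun _ _ => 1, ![f.coeff 0, g.coeff 0], fun _ _ _ => affineEntry_const _, by simp⟩
  | succ n ih =>
    intro f g hf hg
    obtain ⟨u, v, A, hu, hv, hfg⟩ : ∃ (u v : ℝ[X]) (A : Matrix (Fin 2) (Fin 2) ℝ),
        u.natDegree ≤ n ∧ v.natDegree ≤ n + 1 ∧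
        ∀ s, ![f.eval s, g.eval s] = A.mulVec ![u.eval s, v.eval s] := by
      by_cases h : f.coeff (n + 1) = 0
      · refine ⟨f, g, 1, ?_, hg, by simp⟩
        rw [Polynomial.natDegree_le_iff_coeff_eq_zero]
        intro k hk
        rcases (show k = n + 1 ∨ n + 1 < k by omega) with rfl | hk
        · exact h
        · exact Polynomial.coeff_eq_zero_of_natDegree_lt (lt_of_le_of_lt hf hk)
      · refine ⟨g - Polynomial.C (g.coeff (n + 1) / f.coeff (n + 1)) * f, f,
          !![0, 1; 1, g.coeff (n + 1) / f.coeff (n + 1)], ?_, hf, ?_⟩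
        · rw [Polynomial.natDegree_le_iff_coeff_eq_zero]
          intro k hk
          rw [coeff_sub, coeff_C_mul]
          rcases (show k = n + 1 ∨ n + 1 < k by omega) with rfl | hk
          · field_simp
            ring
          · rw [Polynomial.coeff_eq_zero_of_natDegree_lt (p := f) (lt_of_le_of_lt hf hk),
              Polynomial.coeff_eq_zero_of_natDegree_lt (p := g) (lt_of_le_of_lt hg hk)]
            ring
        · intro s
          ext i
          fin_cases i <;> simp [Matrix.mulVec, dotProduct, Fin.sum_univ_two]
    obtain ⟨u', v', μ, lam, ρ, hu', hv', hu1, hv1⟩ := exists_affine_descent n u v hu hv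
    obtain ⟨N, c, hN, hNc⟩ := ih u' v' hu' hv'
    refine ⟨fun k => Nat.casesOn k (fun t => A * !![μ, 0; lam, t - ρ]) N, c, ?_, ?_⟩
    · rintro (_ | k)
      · intro a b
        refine ⟨A a 1 * (if b = 1 then 1 else 0),
          (A * !![μ, 0; lam, -ρ]) a b, fun t => ?_⟩
        fin_cases b <;> simp [Matrix.mul_apply, Fin.sum_univ_two]
        ring
      · exact hN k
    · intro s
      rw [List.range_succ_eq_map, List.map_cons, List.prod_cons, List.map_map]
      have : (List.map ((fun k => (Nat.casesOn k (fun t => A * !![μ, 0; lam, t - ρ]) N :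
          ℝ → Matrix (Fin 2) (Fin 2) ℝ) s) ∘ Nat.succ) (List.range n)) =
          (List.range n).map fun k => N k s := rfl
      rw [← Matrix.mulVec_mulVec, this, hNc, hfg]
      change (A * !![μ, 0; lam, s - ρ]).mulVec _ = _
      rw [← Matrix.mulVec_mulVec, hu1, hv1]
      congr 1
      ext i
      fin_cases i <;> simp [Matrix.mulVec, dotProduct, Fin.sum_univ_two]

/-- The state whose accumulator slots hold `v`, `x` and `acc`, all remaining slots holding `s`. -/
def slotState (q : ℕ) {d κ : ℕ} (v : ℝ) (x : Fin d → ℝ) (acc : Fin κ → ℝ) (s : ℝ) :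
    Fin (d + 2 + q) → ℝ := fun i =>
  if (i : ℕ) = 0 then v
  else if h : (i : ℕ) - 1 < d then x ⟨i - 1, h⟩
  else if h : (i : ℕ) - (d + 1) < κ then acc ⟨i - (d + 1), h⟩ else s

/-- Products of univariate affine functions of the variables and of the accumulators. -/
def IsAffineProd {d κ : ℕ} (u : (Fin d → ℝ) → (Fin κ → ℝ) → ℝ) : Prop :=
  ∃ (a : Fin d → ℝ → ℝ) (b : Fin κ → ℝ → ℝ), (∀ j, AffineEntry (a j)) ∧
    (∀ k, AffineEntry (b k)) ∧ ∀ x acc, u x acc = (∏ j, a j (x j)) * ∏ k, b k (acc k)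

/-- Real functions given by a polynomial of degree at most `n`. -/
def IsPolyOfDegree (n : ℕ) (f : ℝ → ℝ) : Prop :=
  ∃ P : ℝ[X], P.natDegree ≤ n ∧ ∀ s, f s = P.eval s

theorem isPolyOfDegree_const (n : ℕ) (c : ℝ) : IsPolyOfDegree n fun _ => c :=
  ⟨Polynomial.C c, by simp, by simp⟩

theorem isPolyOfDegree_pow {n k : ℕ} (h : k ≤ n) : IsPolyOfDegree n fun s => s ^ k :=
  ⟨X ^ k, by simpa using h, by simp⟩

theorem isPolyOfDegree_id {n : ℕ} (h : 1 ≤ n) : IsPolyOfDegree n fun s => s :=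
  ⟨X, by simpa using h, by simp⟩

theorem IsPolyOfDegree.sub {n : ℕ} {f g : ℝ → ℝ} (hf : IsPolyOfDegree n f)
    (hg : IsPolyOfDegree n g) : IsPolyOfDegree n fun s => f s - g s := by
  obtain ⟨P, hP, hf⟩ := hf
  obtain ⟨Q, hQ, hg⟩ := hg
  exact ⟨P - Q, (natDegree_sub_le _ _).trans (max_le hP hQ), fun s => by
    simp only [hf, hg, eval_sub]⟩

theorem isAffineProd_one {d κ : ℕ} :
    IsAffineProd fun (_ : Fin d → ℝ) (_ : Fin κ → ℝ) => (1 : ℝ) :=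
  ⟨fun _ _ => 1, fun _ _ => 1, fun _ => affineEntry_const _, fun _ => affineEntry_const _,
    by simp⟩

theorem isAffineProd_prod {d κ : ℕ} (e : Finset (Fin d)) :
    IsAffineProd fun (x : Fin d → ℝ) (_ : Fin κ → ℝ) => ∏ j ∈ e, x j := by
  refine ⟨fun j t => if j ∈ e then t else 1, fun _ _ => 1, fun j => ?_,
    fun _ => affineEntry_const _, fun x acc => by simp [Finset.prod_ite_mem]⟩
  dsimp only
  split_ifs
  · exact affineEntry_id
  · exact affineEntry_const _

theorem isAffineProd_var {d κ : ℕ} (j : Fin d) {φ : ℝ → ℝ} (hφ : AffineEntry φ) :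
    IsAffineProd fun (x : Fin d → ℝ) (_ : Fin κ → ℝ) => φ (x j) := by
  refine ⟨fun i t => if i = j then φ t else 1, fun _ _ => 1, fun i => ?_,
    fun _ => affineEntry_const _, fun x acc => by simp [Finset.prod_ite_eq']⟩
  dsimp only
  split_ifs
  · exact hφ
  · exact affineEntry_const _

theorem isAffineProd_acc {d κ : ℕ} (k : Fin κ) {φ : ℝ → ℝ} (hφ : AffineEntry φ) :
    IsAffineProd fun (_ : Fin d → ℝ) (acc : Fin κ → ℝ) => φ (acc k) := by
  refine ⟨fun _ _ => 1, fun i t => if i = k then φ t else 1, fun _ => affineEntry_const _,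
    fun i => ?_, fun x acc => by simp [Finset.prod_ite_eq']⟩
  dsimp only
  split_ifs
  · exact hφ
  · exact affineEntry_const _

/-- The coordinate of a `slotState` that feeds the `k`-th `2 × 2` factor. -/
theorem coordOrZero_slotState {q d κ : ℕ} (v : ℝ) (x : Fin d → ℝ) (acc : Fin κ → ℝ) (s : ℝ)
    {k : ℕ} (hk : k < d + 1 + q) :
    coordOrZero (slotState q v x acc s) (k + 1) = if h : k < d then x ⟨k, h⟩
      else if h : k - d < κ then acc ⟨k - d, h⟩ else s := by
  have h1 : k + 1 < d + 2 + q := by omega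
  have h2 : k + 1 - (d + 1) = k - d := by omega
  simp [coordOrZero, h1, slotState, h2]

theorem exists_layer {q d κ n : ℕ} (hn : κ + n = q + 1)
    {u w : (Fin d → ℝ) → (Fin κ → ℝ) → ℝ} (hu : IsAffineProd u) (hw : IsAffineProd w)
    {f g : ℝ → ℝ} (hf : IsPolyOfDegree n f) (hg : IsPolyOfDegree n g)
    {α γ : ℝ → ℝ} (hα : AffineEntry α) (hγ : AffineEntry γ)
    (αa γa : Fin κ → ℝ) (αs γs : ℝ) :
    ∃ ψ, HasTTAffine (d + 2 + q) ψ 2 ∧ ∀ (v : ℝ) x acc s,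
      slotState q v x acc s + ψ (slotState q v x acc s) =
        slotState q (v + α v * (u x acc * f s) + γ v * (w x acc * g s)) x
          (fun k => acc k + αa k * (u x acc * f s) + γa k * (w x acc * g s))
          (s + αs * (u x acc * f s) + γs * (w x acc * g s)) := by
  obtain ⟨a, b, ha, hb, hu⟩ := hu
  obtain ⟨a', b', ha', hb', hw⟩ := hw
  obtain ⟨F, hF, hf⟩ := hf
  obtain ⟨G, hG, hg⟩ := hg
  obtain ⟨N, c, hN, hNc⟩ := exists_affine_factorization n F G hF hG
  let row : Fin (d + 2 + q) → ℝ → Fin 2 → ℝ := fun i t =>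
    if (i : ℕ) = 0 then ![α t, γ t]
    else if (i : ℕ) - 1 < d then ![0, 0]
    else if h : (i : ℕ) - (d + 1) < κ then ![αa ⟨i - (d + 1), h⟩, γa ⟨i - (d + 1), h⟩]
    else ![αs, γs]
  let φ : ℕ → ℝ → Fin 2 → ℝ := fun k t =>
    if h : k < d then ![a ⟨k, h⟩ t, a' ⟨k, h⟩ t]
    else if h : k - d < κ then ![b ⟨k - d, h⟩ t, b' ⟨k - d, h⟩ t] else 0
  let M : ℕ → ℝ → Matrix (Fin 2) (Fin 2) ℝ := fun k t =>
    if k < d + κ then Matrix.diagonal (φ k t) else N (k - (d + κ)) t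
  have hrow : ∀ i e, AffineEntry fun t => row i t e := by
    intro i e
    simp only [row]
    split_ifs <;> fin_cases e
    · exact hα
    · exact hγ
    all_goals exact affineEntry_const _
  have hφ : ∀ k e, AffineEntry fun t => φ k t e := by
    intro k e
    simp only [φ]
    split_ifs <;> fin_cases e
    · exact ha _
    · exact ha' _
    · exact hb _
    · exact hb' _
    all_goals exact affineEntry_const _
  have hM : ∀ k, AffineMatrix (M k) := by
    intro k e e'
    simp only [M]
    split_ifs
    · simp only [Matrix.diagonal_apply]
      split_ifs
      · exact hφ _ _
      · exact affineEntry_const _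
    · exact hN _ _ _
  refine ⟨_, hasTTAffine_of_prod (m := d + q) (by omega) row hrow M hM c, ?_⟩
  intro v x acc s
  have hprod : ((List.range (d + q + 1)).map fun k =>
      M k (coordOrZero (slotState q v x acc s) (k + 1))).prod.mulVec c =
      ![u x acc * f s, w x acc * g s] := by
    rw [show d + q + 1 = (d + κ) + n by omega, List.range_add, List.map_append, List.map_map,
      List.prod_append, ← Matrix.mulVec_mulVec]
    have h1 : (List.range n).map ((fun k =>
        M k (coordOrZero (slotState q v x acc s) (k + 1))) ∘ fun x => d + κ + x) =
        (List.range n).map fun k => N k s := by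
      refine List.map_congr_left fun k hk => ?_
      rw [List.mem_range] at hk
      have : coordOrZero (slotState q v x acc s) (d + κ + k + 1) = s := by
        rw [coordOrZero_slotState _ _ _ _ (by omega), dif_neg (by omega), dif_neg (by omega)]
      simp only [Function.comp_apply, this, M]
      rw [if_neg (by omega)]
      congr
      omega
    have h2 : (List.range (d + κ)).map (fun k =>
        M k (coordOrZero (slotState q v x acc s) (k + 1))) =
        (List.range (d + κ)).map fun k => Matrix.diagonal
          (φ k (coordOrZero (slotState q v x acc s) (k + 1))) := by
      refine List.map_congr_left fun k hk => ?_
      rw [List.mem_range] at hk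
      simp only [M, if_pos hk]
    rw [h1, h2, hNc, list_prod_diagonal
      (fun k => φ k (coordOrZero (slotState q v x acc s) (k + 1)))]
    have h3 : ∀ j : Fin d, φ j (coordOrZero (slotState q v x acc s) (j + 1)) =
        ![a j (x j), a' j (x j)] := by
      intro j
      rw [coordOrZero_slotState _ _ _ _ (by omega)]
      simp [φ]
    have h4 : ∀ k : Fin κ, φ (d + k) (coordOrZero (slotState q v x acc s) (d + k + 1)) =
        ![b k (acc k), b' k (acc k)] := by
      intro k
      rw [coordOrZero_slotState _ _ _ _ (by omega)]
      simp [φ]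
    ext e
    rw [Matrix.mulVec_diagonal]
    simp only [Finset.prod_range_add]
    rw [Finset.prod_range, Finset.prod_range]
    simp only [h3, h4]
    fin_cases e <;> simp [hu, hw, hf, hg]
  have h0 : coordOrZero (slotState q v x acc s) 0 = v := by
    simp [coordOrZero, slotState]
  funext i
  simp only [Pi.add_apply, hprod, h0, row]
  simp only [slotState]
  split_ifs <;> simp [dotProduct, Fin.sum_univ_two] <;> ring

/-- `F` is turned into `G` by `k` residual tensor-train layers. -/
def Reach (d q k : ℕ) (F G : (Fin d → ℝ) → Fin (d + 2 + q) → ℝ) : Prop :=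
  ∃ l : List ((Fin (d + 2 + q) → ℝ) → Fin (d + 2 + q) → ℝ), l.length = k ∧
    (∀ ψ ∈ l, HasTTAffine (d + 2 + q) ψ 2) ∧
    ∀ x, l.foldl (fun y ψ => y + ψ y) (F x) = G x

theorem Reach.refl {d q : ℕ} (F : (Fin d → ℝ) → Fin (d + 2 + q) → ℝ) : Reach d q 0 F F :=
  ⟨[], rfl, by simp, fun _ => rfl⟩

theorem Reach.trans {d q k l : ℕ} {F G H : (Fin d → ℝ) → Fin (d + 2 + q) → ℝ}
    (h : Reach d q k F G) (h' : Reach d q l G H) : Reach d q (k + l) F H := by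
  obtain ⟨L, hL, hT, hF⟩ := h
  obtain ⟨L', hL', hT', hG⟩ := h'
  refine ⟨L ++ L', by simp [hL, hL'], fun ψ hψ => ?_, fun x => ?_⟩
  · rcases List.mem_append.1 hψ with h | h
    exacts [hT _ h, hT' _ h]
  · rw [List.foldl_append, hF, hG]

theorem Reach.congr {d q k l : ℕ} {F G F' G' : (Fin d → ℝ) → Fin (d + 2 + q) → ℝ}
    (h : Reach d q k F G) (hk : k = l) (hF : ∀ x, F x = F' x) (hG : ∀ x, G x = G' x) :
    Reach d q l F' G' := by
  obtain rfl := hk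
  obtain rfl := funext hF
  obtain rfl := funext hG
  exact h

/-- One layer acting on slot states. -/
theorem reach_layer {q d κ n : ℕ} (hn : κ + n = q + 1)
    {u w : (Fin d → ℝ) → (Fin κ → ℝ) → ℝ} (hu : IsAffineProd u) (hw : IsAffineProd w)
    {f g : ℝ → ℝ} (hf : IsPolyOfDegree n f) (hg : IsPolyOfDegree n g)
    {α γ : ℝ → ℝ} (hα : AffineEntry α) (hγ : AffineEntry γ)
    (αa γa : Fin κ → ℝ) (αs γs : ℝ)
    {v s v' s' : (Fin d → ℝ) → ℝ} {acc acc' : (Fin d → ℝ) → Fin κ → ℝ}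
    (hv : ∀ x, v' x = v x + α (v x) * (u x (acc x) * f (s x)) +
      γ (v x) * (w x (acc x) * g (s x)))
    (ha : ∀ x k, acc' x k = acc x k + αa k * (u x (acc x) * f (s x)) +
      γa k * (w x (acc x) * g (s x)))
    (hs : ∀ x, s' x = s x + αs * (u x (acc x) * f (s x)) + γs * (w x (acc x) * g (s x))) :
    Reach d q 1 (fun x => slotState q (v x) x (acc x) (s x))
      fun x => slotState q (v' x) x (acc' x) (s' x) := by
  obtain ⟨ψ, hψ, h⟩ := exists_layer hn hu hw hf hg hα hγ αa γa αs γs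
  refine ⟨[ψ], rfl, by simpa using hψ, fun x => ?_⟩
  simp only [List.foldl_cons, List.foldl_nil, h, hv, hs, funext (ha x)]

/-- Repeating groups: if sets of size `g` can be processed one after the other, so can sets
whose size is a multiple of `g`. -/
theorem exists_reach_sum {ι : Type*} {d q B g : ℕ} (Λ : Finset ι)
    (term : ι → (Fin d → ℝ) → ℝ)
    (Inv : ((Fin d → ℝ) → ℝ) → ((Fin d → ℝ) → Fin (d + 2 + q) → ℝ) → Prop)
    (hstep : ∀ S ⊆ Λ, S.card = g → ∀ v F, Inv v F →
      ∃ k ≤ g * B, ∃ G, Reach d q k F G ∧ Inv (fun x => v x + ∑ i ∈ S, term i x) G) :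
    ∀ m : ℕ, ∀ S ⊆ Λ, S.card = g * m → ∀ v F, Inv v F →
      ∃ k ≤ g * m * B, ∃ G, Reach d q k F G ∧ Inv (fun x => v x + ∑ i ∈ S, term i x) G := by
  classical
  intro m
  induction m with
  | zero =>
    intro S _ hS v F hF
    obtain rfl := Finset.card_eq_zero.1 (by simpa using hS)
    exact ⟨0, by simp, F, Reach.refl F, by simpa using hF⟩
  | succ m ih =>
    intro S hSΛ hS v F hF
    obtain ⟨R, hR, hRc⟩ := Finset.exists_subset_card_eq (s := S) (n := g) (by rw [hS]; nlinarith)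
    obtain ⟨k, hk, G, hG, hI⟩ := hstep R (hR.trans hSΛ) hRc v F hF
    obtain ⟨k', hk', G', hG', hI'⟩ := ih (S \ R) (Finset.sdiff_subset.trans hSΛ)
      (by rw [Finset.card_sdiff_of_subset hR, hS, hRc, Nat.mul_succ, Nat.add_sub_cancel]) _ G hI
    refine ⟨k + k', by nlinarith, G', hG.trans hG', ?_⟩
    convert hI' using 2 with x
    rw [← Finset.sum_sdiff hR]
    ring

/-- States with a single accumulator `A` besides the output slot. -/
def oneState (q : ℕ) {d : ℕ} (v A s : (Fin d → ℝ) → ℝ) (x : Fin d → ℝ) :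
    Fin (d + 2 + q) → ℝ := slotState q (v x) x ![A x] (s x)

theorem affineEntry_mul_left (c : ℝ) : AffineEntry fun t => c * t :=
  ⟨c, 0, fun t => by ring⟩

theorem affineEntry_sub_const (c : ℝ) : AffineEntry fun t => t - c :=
  ⟨1, -c, fun t => by ring⟩

theorem affineEntry_const_sub (c : ℝ) : AffineEntry fun t => c - t :=
  ⟨-1, c, fun t => by ring⟩

theorem reach_layer_one {q d : ℕ} {u w : (Fin d → ℝ) → (Fin 1 → ℝ) → ℝ} (hu : IsAffineProd u)
    (hw : IsAffineProd w) {f g : ℝ → ℝ} (hf : IsPolyOfDegree q f) (hg : IsPolyOfDegree q g)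
    {α γ : ℝ → ℝ} (hα : AffineEntry α) (hγ : AffineEntry γ) (αa γa αs γs : ℝ)
    {v s v' s' A A' : (Fin d → ℝ) → ℝ}
    (h : ∀ x,
      v' x = v x + α (v x) * (u x ![A x] * f (s x)) + γ (v x) * (w x ![A x] * g (s x)) ∧
      A' x = A x + αa * (u x ![A x] * f (s x)) + γa * (w x ![A x] * g (s x)) ∧
      s' x = s x + αs * (u x ![A x] * f (s x)) + γs * (w x ![A x] * g (s x))) :
    Reach d q 1 (oneState q v A s) (oneState q v' A' s') :=
  reach_layer (κ := 1) (n := q) (by omega) hu hw hf hg hα hγ (fun _ => αa) (fun _ => γa) αs γs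
    (fun x => (h x).1) (fun x k => by fin_cases k; exact (h x).2.1) fun x => (h x).2.2

theorem Reach.congr_oneState {q d k l : ℕ} {F : (Fin d → ℝ) → Fin (d + 2 + q) → ℝ}
    {v A s v' A' s' : (Fin d → ℝ) → ℝ} (h : Reach d q k F (oneState q v A s)) (hk : k = l)
    (hv : ∀ x, v x = v' x) (hA : ∀ x, A x = A' x) (hs : ∀ x, s x = s' x) :
    Reach d q l F (oneState q v' A' s') := by
  obtain rfl := hk
  obtain rfl := funext hv
  obtain rfl := funext hA
  obtain rfl := funext hs
  exact h

section OneAccumulator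

variable {q d : ℕ} (v A s : (Fin d → ℝ) → ℝ)

theorem reach_reset (hq : 1 ≤ q) :
    Reach d q 1 (oneState q v A s) (oneState q v (fun _ => 1) fun _ => 1) :=
  reach_layer_one (isAffineProd_acc 0 (affineEntry_const_sub 1)) isAffineProd_one
    (isPolyOfDegree_const _ 1) ((isPolyOfDegree_const _ 1).sub (isPolyOfDegree_id hq))
    (affineEntry_const 0) (affineEntry_const 0) 1 0 0 1 fun x => by simp

theorem reach_telescope (hq : 1 ≤ q) (j : Fin d) {c : ℕ} (hc : c ≤ q) :
    Reach d q 1 (oneState q v A s)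
      (oneState q v (fun x => A x * s x ^ c) fun x => s x * x j) :=
  reach_layer_one (isAffineProd_acc 0 affineEntry_id) (isAffineProd_var j (affineEntry_sub_const 1))
    ((isPolyOfDegree_pow hc).sub (isPolyOfDegree_const _ 1)) (isPolyOfDegree_id hq)
    (affineEntry_const 0) (affineEntry_const 0) 1 0 0 1 fun x => by
      refine ⟨by ring, ?_, ?_⟩
      · simp
        ring
      · simp
        ring

theorem reach_output (c : ℝ) {m : ℕ} (hm : m ≤ q) :
    Reach d q 1 (oneState q v A s) (oneState q (fun x => v x + c * (A x * s x ^ m)) A s) :=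
  reach_layer_one (isAffineProd_acc 0 affineEntry_id) isAffineProd_one
    (isPolyOfDegree_pow hm) (isPolyOfDegree_const _ 1)
    (affineEntry_const c) (affineEntry_const 0) 0 0 0 0 fun x => by simp

theorem reach_output_clear (hq : 1 ≤ q) (c : ℝ) {m : ℕ} (hm : m ≤ q) :
    Reach d q 1 (oneState q v A s)
      (oneState q (fun x => v x + c * (A x * s x ^ m)) A fun _ => 0) :=
  reach_layer_one (isAffineProd_acc 0 affineEntry_id) isAffineProd_one
    (isPolyOfDegree_pow hm) (isPolyOfDegree_id hq)
    (affineEntry_const c) (affineEntry_const 0) 0 0 0 (-1) fun x => by simp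

theorem reach_mul_clear (hq : 1 ≤ q) {m : ℕ} (hm : m ≤ q) :
    Reach d q 1 (oneState q v A s) (oneState q v (fun x => A x * s x ^ m) fun _ => 0) :=
  reach_layer_one (isAffineProd_acc 0 affineEntry_id) isAffineProd_one
    ((isPolyOfDegree_pow hm).sub (isPolyOfDegree_const _ 1)) (isPolyOfDegree_id hq)
    (affineEntry_const 0) (affineEntry_const 0) 1 0 0 (-1) fun x => by
      refine ⟨by ring, ?_, ?_⟩
      · simp
        ring
      · simp

theorem reach_mul_pow {a : ℕ} (ha : a ≤ q) (hq : 1 ≤ q) :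
    Reach d q 1 (oneState q v A s)
      (oneState q v (fun x => A x * s x ^ a) fun x => s x ^ q) :=
  reach_layer_one (isAffineProd_acc 0 affineEntry_id) isAffineProd_one
    ((isPolyOfDegree_pow ha).sub (isPolyOfDegree_const _ 1))
    ((isPolyOfDegree_pow le_rfl).sub (isPolyOfDegree_id hq))
    (affineEntry_const 0) (affineEntry_const 0) 1 0 0 1 fun x => by
      refine ⟨by ring, ?_, by simp⟩
      simp
      ring

theorem reach_load (hq : 1 ≤ q) (j : Fin d) :
    Reach d q 1 (oneState q v A s) (oneState q v A fun x => x j) :=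
  reach_layer_one (isAffineProd_var j affineEntry_id) isAffineProd_one
    (isPolyOfDegree_const _ 1) (isPolyOfDegree_id hq)
    (affineEntry_const 0) (affineEntry_const 0) 0 0 1 (-1) fun x => by simp

theorem reach_reset_load (j : Fin d) :
    Reach d q 1 (oneState q v A fun _ => 0) (oneState q v (fun _ => 1) fun x => x j) :=
  reach_layer_one (isAffineProd_var j affineEntry_id)
    (isAffineProd_acc 0 (affineEntry_const_sub 1))
    (isPolyOfDegree_const _ 1) (isPolyOfDegree_const _ 1)
    (affineEntry_const 0) (affineEntry_const 0) 0 1 1 0 fun x => by simp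

/-- Multiplication by powers of all variables in `S`, in decreasing order of the exponents. -/
theorem reach_telescope_prod (hq : 1 ≤ q) (α : Fin d → ℕ) (hα : ∀ j, α j ≤ q)
    (S : Finset (Fin d)) : ∃ m ≤ q, (∀ i ∈ S, m ≤ α i) ∧
      (∀ b ≤ q, (∀ i ∈ S, b ≤ α i) → b ≤ m) ∧
      Reach d q S.card (oneState q v (fun _ => 1) fun _ => 1)
        (oneState q v (fun x => ∏ i ∈ S, x i ^ (α i - m)) fun x => ∏ i ∈ S, x i) := by
  classical
  induction S using Finset.induction_on_min_value α with
  | empty => exact ⟨q, le_rfl, by simp, by simp, by simpa using Reach.refl _⟩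
  | insert a S haS hmin ih =>
    obtain ⟨m, hmq, hm, hglb, hR⟩ := ih
    have ham : α a ≤ m := hglb _ (hα a) hmin
    refine ⟨α a, hα a, fun i hi => ?_, fun b _ hb => hb a (by simp), ?_⟩
    · rcases Finset.mem_insert.1 hi with rfl | hi
      exacts [le_rfl, hmin i hi]
    refine (hR.trans (reach_telescope _ _ _ hq a (c := m - α a) (by omega))).congr_oneState
      (by simp [haS]) (fun _ => rfl) (fun x => ?_) fun x => by
        rw [Finset.prod_insert haS, mul_comm]
    simp only [Finset.prod_insert haS, Nat.sub_self, pow_zero, one_mul]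
    rw [← Finset.prod_pow, ← Finset.prod_mul_distrib]
    refine Finset.prod_congr rfl fun i hi => ?_
    rw [← pow_add]
    congr 1
    have := hm i hi
    omega

theorem reach_monomial_of_le (hq : 1 ≤ q) (c : ℝ) (α : Fin d → ℕ) (hα : ∀ j, α j ≤ q) :
    ∃ A' s', Reach d q (d + 2) (oneState q v A s)
      (oneState q (fun x => v x + c * ∏ j, x j ^ α j) A' s') := by
  obtain ⟨m, hmq, hm, -, hR⟩ := reach_telescope_prod v hq α hα Finset.univ
  refine ⟨_, _, (((reach_reset v A s hq).trans hR).trans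
    (reach_output _ _ _ c hmq)).congr_oneState (by simp; omega) (fun x => ?_) (fun _ => rfl)
    fun _ => rfl⟩
  rw [← Finset.prod_pow, ← Finset.prod_mul_distrib]
  congr 2
  refine Finset.prod_congr rfl fun i hi => ?_
  rw [← pow_add]
  congr 1
  have := hm i hi
  omega

/-- Reading off all but the leading base-`q` digit of an exponent. -/
theorem reach_digits (hq : 1 ≤ q) (T : ℕ) : ∀ (A s : (Fin d → ℝ) → ℝ) (a : ℕ), a < q ^ (T + 1) →
    ∃ r t, t ≤ q ∧ r + q ^ T * t = a ∧ Reach d q T (oneState q v A s)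
      (oneState q v (fun x => A x * s x ^ r) fun x => s x ^ q ^ T) := by
  induction T with
  | zero =>
    intro A s a ha
    exact ⟨0, a, by simpa using ha.le, by simp,
      (Reach.refl _).congr_oneState rfl (fun _ => rfl) (by simp) (by simp)⟩
  | succ T ih =>
    intro A s a ha
    have hlt : a / q < q ^ (T + 1) := Nat.div_lt_of_lt_mul (by rwa [← pow_succ'])
    obtain ⟨r, t, ht, hrt, hR⟩ := ih (fun x => A x * s x ^ (a % q)) (fun x => s x ^ q) _ hlt
    refine ⟨a % q + q * r, t, ht, ?_, ((reach_mul_pow v A s (Nat.mod_lt a hq).le hq).trans hR).congr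
      (by omega) (fun _ => rfl) fun x => ?_⟩
    · conv_rhs => rw [← Nat.mod_add_div a q, ← hrt]
      ring
    · simp only [oneState]
      rw [pow_add, pow_mul, mul_assoc, ← pow_mul (s x) q (q ^ T), ← pow_succ']

theorem reach_monomial_fin_one (hq : 1 ≤ q) (T : ℕ) (v A : (Fin 1 → ℝ) → ℝ) (c : ℝ)
    (α : Fin 1 → ℕ) (hα : ∀ j, α j < q ^ (T + 1)) :
    ∃ A', Reach 1 q (T + 2) (oneState q v A fun _ => 0)
      (oneState q (fun x => v x + c * ∏ j, x j ^ α j) A' fun _ => 0) := by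
  obtain ⟨r, t, ht, hrt, hR⟩ := reach_digits v hq T (fun _ => 1) (fun x => x 0) _ (hα 0)
  refine ⟨_, (((reach_reset_load v A 0).trans hR).trans
    (reach_output_clear _ _ _ hq c ht)).congr_oneState (by omega) (fun x => ?_) (fun _ => rfl)
    fun _ => rfl⟩
  simp only [Fin.prod_univ_one, ← hrt, pow_add, pow_mul, one_mul]

theorem reach_monomial_fin_two (hq : 1 ≤ q) (T : ℕ) (v A : (Fin 2 → ℝ) → ℝ) (c : ℝ)
    (α : Fin 2 → ℕ) (hα : ∀ j, α j < q ^ (T + 1)) :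
    ∃ A', Reach 2 q (2 * T + 4) (oneState q v A fun _ => 0)
      (oneState q (fun x => v x + c * ∏ j, x j ^ α j) A' fun _ => 0) := by
  obtain ⟨r, t, ht, hrt, hR⟩ := reach_digits v hq T (fun _ => 1) (fun x => x 0) _ (hα 0)
  obtain ⟨r', t', ht', hrt', hR'⟩ := reach_digits v hq T
    (fun x => 1 * x 0 ^ r * (x 0 ^ q ^ T) ^ t) (fun x => x 1) _ (hα 1)
  refine ⟨_, ((((((reach_reset_load v A 0).trans hR).trans (reach_mul_clear _ _ _ hq ht)).trans
    (reach_load _ _ _ hq 1)).trans hR').trans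
    (reach_output_clear _ _ _ hq c ht')).congr_oneState (by omega) (fun x => ?_) (fun _ => rfl)
    fun _ => rfl⟩
  simp only [Fin.prod_univ_two, ← hrt, ← hrt', pow_add, pow_mul, one_mul]
  congr 2
  ring

end OneAccumulator

section NoAccumulator

/-- States without accumulators besides the output slot. -/
def zeroState (q : ℕ) {d : ℕ} (v s : (Fin d → ℝ) → ℝ) (x : Fin d → ℝ) :
    Fin (d + 2 + q) → ℝ := slotState q (v x) x ![] (s x)

variable {q d : ℕ} (v s : (Fin d → ℝ) → ℝ)

theorem reach_set_one : Reach d q 1 (zeroState q v s) (zeroState q v fun _ => 1) :=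
  reach_layer (κ := 0) (n := q + 1) (by omega) isAffineProd_one isAffineProd_one
    (isPolyOfDegree_const _ 1) (isPolyOfDegree_id (by omega)) (affineEntry_const 0)
    (affineEntry_const 0) 0 0 1 (-1) (by simp) (fun _ k => k.elim0) (by simp)

theorem reach_square (hq : 1 ≤ q) (e : Finset (Fin d)) :
    Reach d q 1 (zeroState q v s) (zeroState q v fun x => s x ^ 2 * ∏ j ∈ e, x j) :=
  reach_layer (κ := 0) (n := q + 1) (by omega) (isAffineProd_prod e) isAffineProd_one
    (isPolyOfDegree_pow (k := 2) (by omega)) (isPolyOfDegree_id (by omega)) (affineEntry_const 0)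
    (affineEntry_const 0) 0 0 1 (-1) (by simp) (fun _ k => k.elim0) (by simp [mul_comm])

theorem reach_output_slot (c : ℝ) :
    Reach d q 1 (zeroState q v s) (zeroState q (fun x => v x + c * s x) s) :=
  reach_layer (κ := 0) (n := q + 1) (by omega) isAffineProd_one isAffineProd_one
    (isPolyOfDegree_id (by omega)) (isPolyOfDegree_const _ 1) (affineEntry_const c)
    (affineEntry_const 0) 0 0 0 0 (by simp) (fun _ k => k.elim0) (by simp)

theorem reach_horner (hq : 1 ≤ q) (b : ℕ) : ∀ β : Fin d → ℕ, (∀ j, β j < 2 ^ b) →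
    Reach d q b (zeroState q v fun _ => 1) (zeroState q v fun x => ∏ j, x j ^ β j) := by
  induction b with
  | zero =>
    intro β hβ
    have : ∀ j, β j = 0 := fun j => by simpa using hβ j
    exact (Reach.refl _).congr rfl (fun _ => rfl) (by simp [zeroState, this])
  | succ b ih =>
    intro β hβ
    have h := ih (fun j => β j / 2) fun j => Nat.div_lt_of_lt_mul (by
      rw [← pow_succ']; exact hβ j)
    refine (h.trans (reach_square _ _ hq (Finset.univ.filter fun j => β j % 2 = 1))).congr rfl
      (fun _ => rfl) fun x => ?_
    simp only [zeroState]
    rw [Finset.prod_filter, ← Finset.prod_pow, ← Finset.prod_mul_distrib]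
    congr 1
    refine Finset.prod_congr rfl fun j _ => ?_
    rcases Nat.mod_two_eq_zero_or_one (β j) with h0 | h0
    · rw [if_neg (by omega), mul_one, ← pow_mul, Nat.div_mul_cancel (Nat.dvd_of_mod_eq_zero h0)]
    · rw [if_pos h0, ← pow_mul, ← pow_succ]
      congr 1
      omega

theorem reach_monomial_of_binary (hq : 1 ≤ q) (b : ℕ) (c : ℝ) (β : Fin d → ℕ)
    (hβ : ∀ j, β j < 2 ^ b) :
    ∃ s', Reach d q (b + 2) (zeroState q v s)
      (zeroState q (fun x => v x + c * ∏ j, x j ^ β j) s') :=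
  ⟨_, (((reach_set_one v s).trans (reach_horner v hq b β hβ)).trans
    (reach_output_slot _ _ c)).congr (by omega) (fun _ => rfl) fun _ => rfl⟩

end NoAccumulator

section MultiplicativeOutput

variable {q d : ℕ} (v B s : (Fin d → ℝ) → ℝ)

theorem reach_mul_mul {a b : ℕ} (ha : a ≤ q) (hb : b ≤ q) :
    Reach d q 1 (oneState q v B s)
      (oneState q (fun x => v x * s x ^ a) (fun x => B x * s x ^ b) s) :=
  reach_layer_one isAffineProd_one (isAffineProd_acc 0 affineEntry_id)
    ((isPolyOfDegree_pow ha).sub (isPolyOfDegree_const _ 1))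
    ((isPolyOfDegree_pow hb).sub (isPolyOfDegree_const _ 1))
    affineEntry_id (affineEntry_const 0) 0 1 0 0 fun x => by
      refine ⟨by ring, ?_, by simp⟩
      simp
      ring

theorem reach_pow (hq : 1 ≤ q) :
    Reach d q 1 (oneState q v B s) (oneState q v B fun x => s x ^ q) :=
  reach_layer_one isAffineProd_one isAffineProd_one
    ((isPolyOfDegree_pow le_rfl).sub (isPolyOfDegree_id hq)) (isPolyOfDegree_const _ 1)
    (affineEntry_const 0) (affineEntry_const 0) 0 0 1 0 fun x => by simp

theorem reach_mul_output_pow (hq : 1 ≤ q) {a : ℕ} (ha : a ≤ q) :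
    Reach d q 1 (oneState q v B s) (oneState q (fun x => v x * s x ^ a) B fun x => s x ^ q) :=
  reach_layer_one isAffineProd_one isAffineProd_one
    ((isPolyOfDegree_pow ha).sub (isPolyOfDegree_const _ 1))
    ((isPolyOfDegree_pow le_rfl).sub (isPolyOfDegree_id hq))
    affineEntry_id (affineEntry_const 0) 0 0 0 1 fun x => by
      refine ⟨by ring, by simp, by simp⟩

theorem reach_add_one_add_one :
    Reach d q 1 (oneState q (fun _ => 0) (fun _ => 0) fun _ => 0)
      (oneState q (fun _ => 1) (fun _ => 1) fun _ => 0) :=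
  reach_layer_one isAffineProd_one isAffineProd_one
    (isPolyOfDegree_const _ 1) (isPolyOfDegree_const _ 1)
    (affineEntry_const 1) (affineEntry_const 0) 1 0 0 0 fun x => by simp

theorem reach_add_one_add_one_load (j : Fin d) :
    Reach d q 1 (oneState q (fun _ => 0) (fun _ => 0) fun _ => 0)
      (oneState q (fun _ => 1) (fun _ => 1) fun x => x j) :=
  reach_layer_one isAffineProd_one (isAffineProd_var j affineEntry_id)
    (isPolyOfDegree_const _ 1) (isPolyOfDegree_const _ 1)
    (affineEntry_const 1) (affineEntry_const 0) 1 0 0 1 fun x => by simp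

theorem reach_linear_combination (c c' : ℝ) :
    Reach d q 1 (oneState q v B s) (oneState q (fun x => c * v x + c' * B x) B s) :=
  reach_layer_one isAffineProd_one (isAffineProd_acc 0 affineEntry_id)
    (isPolyOfDegree_const _ 1) (isPolyOfDegree_const _ 1)
    (affineEntry_mul_left (c - 1)) (affineEntry_const c') 0 0 0 0 fun x => by
      refine ⟨?_, by simp, by simp⟩
      simp
      ring

theorem reach_load_acc (hq : 1 ≤ q) :
    Reach d q 1 (oneState q v B s) (oneState q v B B) :=
  reach_layer_one (isAffineProd_acc 0 affineEntry_id) isAffineProd_one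
    (isPolyOfDegree_const _ 1) (isPolyOfDegree_id hq)
    (affineEntry_const 0) (affineEntry_const 0) 0 0 1 (-1) fun x => by simp

theorem reach_scale_mul_pow (hq : 1 ≤ q) (c : ℝ) :
    Reach d q 1 (oneState q v B B) (oneState q (fun x => c * (v x * B x ^ q)) B B) :=
  reach_layer_one (isAffineProd_acc 0 affineEntry_id) isAffineProd_one
    (isPolyOfDegree_pow (k := q - 1) (by omega)) (isPolyOfDegree_const _ 1)
    (affineEntry_mul_left c) (affineEntry_mul_left (-1)) 0 0 0 0 fun x => by
      refine ⟨?_, by simp, by simp⟩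
      simp only [Matrix.cons_val_zero]
      rw [mul_pow_sub_one (by omega)]
      ring

theorem reach_mul_mul_of_lt (hq : 1 ≤ q) (T : ℕ) : ∀ (v B s : (Fin d → ℝ) → ℝ) (a b : ℕ),
    a < q ^ (T + 1) → b < q ^ (T + 1) →
    ∃ s', Reach d q (2 * T + 1) (oneState q v B s)
      (oneState q (fun x => v x * s x ^ a) (fun x => B x * s x ^ b) s') := by
  induction T with
  | zero =>
    intro v B s a b ha hb
    exact ⟨_, reach_mul_mul v B s (by simpa using ha.le) (by simpa using hb.le)⟩
  | succ T ih =>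
    intro v B s a b ha hb
    obtain ⟨s', h⟩ := ih (fun x => v x * s x ^ (a % q)) (fun x => B x * s x ^ (b % q))
      (fun x => s x ^ q) (a / q) (b / q)
      (Nat.div_lt_of_lt_mul (by rwa [← pow_succ'])) (Nat.div_lt_of_lt_mul (by rwa [← pow_succ']))
    refine ⟨s', (((reach_mul_mul v B s (Nat.mod_lt a hq).le (Nat.mod_lt b hq).le).trans
      (reach_pow _ _ _ hq)).trans h).congr_oneState (by omega) (fun x => ?_) (fun x => ?_)
      fun _ => rfl⟩
    all_goals rw [← pow_mul, mul_assoc, ← pow_add, Nat.mod_add_div]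

/-- Two monomials, built up in the output slot and in the accumulator. -/
theorem reach_two_monomials (hq : 1 ≤ q) (T : ℕ) (c c' : ℝ) (α β : Fin d → ℕ)
    (hα : ∀ j, α j < q ^ (T + 1)) (hβ : ∀ j, β j < q ^ (T + 1)) :
    ∃ A' s', Reach d q (2 * (d * (T + 1)) + 2) (oneState q (fun _ => 0) (fun _ => 0) fun _ => 0)
      (oneState q (fun x => c * ∏ j, x j ^ α j + c' * ∏ j, x j ^ β j) A' s') := by
  classical
  have key : ∀ S : Finset (Fin d), ∃ s', Reach d q (2 * (S.card * (T + 1)))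
      (oneState q (fun _ => 1) (fun _ => 1) fun _ => 0)
      (oneState q (fun x => ∏ j ∈ S, x j ^ α j) (fun x => ∏ j ∈ S, x j ^ β j) s') := by
    intro S
    induction S using Finset.induction_on with
    | empty => exact ⟨_, by simpa using Reach.refl _⟩
    | insert j S hj ih =>
      obtain ⟨s', hS⟩ := ih
      obtain ⟨s'', h⟩ := reach_mul_mul_of_lt hq T (fun x => ∏ j ∈ S, x j ^ α j)
        (fun x => ∏ j ∈ S, x j ^ β j) (fun x => x j) _ _ (hα j) (hβ j)
      refine ⟨s'', ((hS.trans (reach_load _ _ _ hq j)).trans h).congr_oneState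
        ?_ (fun x => ?_) (fun x => ?_) fun _ => rfl⟩
      · rw [Finset.card_insert_of_notMem hj]
        ring
      all_goals rw [Finset.prod_insert hj, mul_comm]
  obtain ⟨s', h⟩ := key Finset.univ
  exact ⟨_, _, ((reach_add_one_add_one.trans h).trans
    (reach_linear_combination _ _ _ c c')).congr_oneState (by simp; omega) (fun _ => rfl)
    (fun _ => rfl) fun _ => rfl⟩

theorem reach_split_pow (hq : 1 ≤ q) (t : ℕ) : ∀ (v B s : (Fin d → ℝ) → ℝ) (a : ℕ),
    a < q ^ (t + 2) → ∃ v' B' s', (∀ x, v' x * B' x ^ q = v x * B x ^ q * s x ^ a) ∧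
      Reach d q (t + 1) (oneState q v B s) (oneState q v' B' s') := by
  induction t with
  | zero =>
    intro v B s a ha
    refine ⟨_, _, _, fun x => ?_, reach_mul_mul v B s (Nat.mod_lt a hq).le
      (Nat.div_lt_of_lt_mul (k := q) (m := a) (n := q) (by rwa [← sq])).le⟩
    conv_rhs => rw [← Nat.mod_add_div a q]
    rw [mul_pow, ← pow_mul, pow_add, mul_comm q]
    ring
  | succ t ih =>
    intro v B s a ha
    obtain ⟨v', B', s', hv, h⟩ := ih (fun x => v x * s x ^ (a % q)) B (fun x => s x ^ q) (a / q)
      (Nat.div_lt_of_lt_mul (by rwa [← pow_succ']))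
    refine ⟨v', B', s', fun x => ?_,
      ((reach_mul_output_pow v B s hq (Nat.mod_lt a hq).le).trans h).congr (by omega)
        (fun _ => rfl) fun _ => rfl⟩
    rw [hv]
    conv_rhs => rw [← Nat.mod_add_div a q]
    rw [pow_add, pow_mul]
    ring

/-- A first monomial, built up in the output slot. -/
theorem reach_first_monomial (hq : 1 ≤ q) (hd : 1 ≤ d) (t : ℕ) (c : ℝ) (α : Fin d → ℕ)
    (hα : ∀ j, α j < q ^ (t + 2)) :
    ∃ A' s', Reach d q (d * (t + 2) + 2) (oneState q (fun _ => 0) (fun _ => 0) fun _ => 0)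
      (oneState q (fun x => c * ∏ j, x j ^ α j) A' s') := by
  classical
  have key : ∀ S : Finset (Fin d), S.Nonempty → ∃ v' B' s',
      (∀ x, v' x * B' x ^ q = ∏ j ∈ S, x j ^ α j) ∧ Reach d q (S.card * (t + 2))
        (oneState q (fun _ => 0) (fun _ => 0) fun _ => 0) (oneState q v' B' s') := by
    intro S hS
    induction hS using Finset.Nonempty.cons_induction with
    | singleton j =>
      obtain ⟨v', B', s', hv, h⟩ := reach_split_pow hq t (fun _ => 1) (fun _ => 1)
        (fun x => x j) _ (hα j)
      exact ⟨v', B', s', by simpa using hv, ((reach_add_one_add_one_load j).trans h).congr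
        (by simp; omega) (fun _ => rfl) fun _ => rfl⟩
    | cons j S hj _ ih =>
      obtain ⟨v, B, s, hv, h⟩ := ih
      obtain ⟨v', B', s', hv', h'⟩ := reach_split_pow hq t v B (fun x => x j) _ (hα j)
      refine ⟨v', B', s', fun x => ?_, ((h.trans (reach_load _ _ _ hq j)).trans h').congr
        ?_ (fun _ => rfl) fun _ => rfl⟩
      · rw [hv', hv, Finset.prod_cons, mul_comm]
      · rw [Finset.card_cons]
        ring
  obtain ⟨v', B', s', hv, h⟩ := key Finset.univ ⟨⟨0, hd⟩, Finset.mem_univ _⟩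
  exact ⟨_, _, ((h.trans (reach_load_acc _ _ _ hq)).trans
    (reach_scale_mul_pow _ _ hq c)).congr_oneState (by simp) (fun x => by rw [hv])
    (fun _ => rfl) fun _ => rfl⟩

end MultiplicativeOutput

section ThreeAccumulators

/-- States with three accumulators besides the output slot. -/
def threeState (q : ℕ) {d : ℕ} (v : (Fin d → ℝ) → ℝ) (A : (Fin d → ℝ) → Fin 3 → ℝ)
    (s : (Fin d → ℝ) → ℝ) (x : Fin d → ℝ) : Fin (d + 2 + q) → ℝ :=
  slotState q (v x) x (A x) (s x)

variable {n d : ℕ} (v s : (Fin d → ℝ) → ℝ) (A : (Fin d → ℝ) → Fin 3 → ℝ)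

theorem Reach.congr_threeState {k l : ℕ} {F : (Fin d → ℝ) → Fin (d + 2 + (n + 2)) → ℝ}
    {v s v' s' : (Fin d → ℝ) → ℝ} {A A' : (Fin d → ℝ) → Fin 3 → ℝ}
    (h : Reach d (n + 2) k F (threeState _ v A s)) (hk : k = l)
    (hv : ∀ x, v x = v' x) (hA : ∀ x i, A x i = A' x i) (hs : ∀ x, s x = s' x) :
    Reach d (n + 2) l F (threeState _ v' A' s') := by
  obtain rfl := hk
  obtain rfl := funext hv
  obtain rfl := funext fun x => funext (hA x)
  obtain rfl := funext hs
  exact h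

theorem reach_three_set_one (i : Fin 3) :
    Reach d (n + 2) 1 (threeState _ v A s)
      (threeState _ v (fun x l => if l = i then 1 else A x l) s) :=
  reach_layer (κ := 3) (n := n) (by omega) (isAffineProd_acc i (affineEntry_const_sub 1))
    isAffineProd_one (isPolyOfDegree_const _ 1) (isPolyOfDegree_const _ 1)
    (affineEntry_const 0) (affineEntry_const 0) (Pi.single i 1) 0 0 0 (by simp)
    (fun x l => by by_cases h : l = i <;> simp [h]) (by simp)

theorem reach_three_mul {i k : Fin 3} (hik : i ≠ k) {a b : ℕ} (ha : a ≤ n) (hb : b ≤ n) :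
    Reach d (n + 2) 1 (threeState _ v A s) (threeState _ v
      (fun x l => A x l * s x ^ (if l = i then a else if l = k then b else 0)) s) :=
  reach_layer (κ := 3) (n := n) (by omega) (isAffineProd_acc i affineEntry_id)
    (isAffineProd_acc k affineEntry_id)
    ((isPolyOfDegree_pow ha).sub (isPolyOfDegree_const _ 1))
    ((isPolyOfDegree_pow hb).sub (isPolyOfDegree_const _ 1))
    (affineEntry_const 0) (affineEntry_const 0) (Pi.single i 1) (Pi.single k 1) 0 0 (by simp)
    (fun x l => by
      by_cases h : l = i
      · subst h
        simp [hik]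
        ring
      · by_cases h' : l = k
        · subst h'
          simp [h]
          ring
        · simp [h, h']) (by simp)

theorem reach_three_mul_pow (hn : 1 ≤ n) (i : Fin 3) {a : ℕ} (ha : a ≤ n) :
    Reach d (n + 2) 1 (threeState _ v A s) (threeState _ v
      (fun x l => A x l * s x ^ (if l = i then a else 0)) fun x => s x ^ n) :=
  reach_layer (κ := 3) (n := n) (by omega) (isAffineProd_acc i affineEntry_id)
    isAffineProd_one ((isPolyOfDegree_pow ha).sub (isPolyOfDegree_const _ 1))
    ((isPolyOfDegree_pow le_rfl).sub (isPolyOfDegree_id hn))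
    (affineEntry_const 0) (affineEntry_const 0) (Pi.single i 1) 0 0 1 (by simp)
    (fun x l => by
      by_cases h : l = i
      · subst h
        simp
        ring
      · simp [h]) (by simp)

theorem reach_three_load (hn : 1 ≤ n) (j : Fin d) :
    Reach d (n + 2) 1 (threeState _ v A s) (threeState _ v A fun x => x j) :=
  reach_layer (κ := 3) (n := n) (by omega) (isAffineProd_var j affineEntry_id)
    isAffineProd_one (isPolyOfDegree_const _ 1) (isPolyOfDegree_id hn)
    (affineEntry_const 0) (affineEntry_const 0) 0 0 1 (-1) (by simp) (by simp) (by simp)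

theorem reach_three_output (c : ℝ) (i : Fin 3) :
    Reach d (n + 2) 1 (threeState _ v A s) (threeState _ (fun x => v x + c * A x i) A s) :=
  reach_layer (κ := 3) (n := n) (by omega) (isAffineProd_acc i affineEntry_id)
    isAffineProd_one (isPolyOfDegree_const _ 1) (isPolyOfDegree_const _ 1)
    (affineEntry_const c) (affineEntry_const 0) 0 0 0 0 (by simp) (by simp) (by simp)

/-- Within `k` layers, the three accumulators can be multiplied by any three powers of the slot
value with exponents below `M`. -/
def PowersReachable (d n k M : ℕ) : Prop :=
  ∀ (v s : (Fin d → ℝ) → ℝ) (A : (Fin d → ℝ) → Fin 3 → ℝ) (e : Fin 3 → ℕ), (∀ l, e l < M) →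
    ∃ s', Reach d (n + 2) k (threeState _ v A s)
      (threeState _ v (fun x l => A x l * s x ^ e l) s')

theorem PowersReachable.mono {k M M' : ℕ} (h : PowersReachable d n k M) (hM : M' ≤ M) :
    PowersReachable d n k M' :=
  fun v s A e he => h v s A e fun l => (he l).trans_le hM

theorem powersReachable_two : PowersReachable d n 2 (n + 1) := by
  intro v s A e he
  have he' : ∀ l, e l ≤ n := fun l => Nat.le_of_lt_succ (he l)
  refine ⟨_, ((reach_three_mul v s A (i := 0) (k := 1) (by decide) (he' 0) (he' 1)).trans
    (reach_three_mul _ _ _ (i := 2) (k := 0) (by decide) (he' 2)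
      (Nat.zero_le n))).congr_threeState rfl (fun _ => rfl) (fun x i => ?_) fun _ => rfl⟩
  fin_cases i <;> simp

theorem powersReachable_three : PowersReachable d n 3 (2 * n + 1) := by
  intro v s A e he
  have he' : ∀ l, e l - min (e l) n ≤ n := fun l => by have := he l; omega
  have hadd : ∀ l, min (e l) n + (e l - min (e l) n) = e l := fun l => by omega
  have hm : ∀ l, min (e l) n ≤ n := fun l => min_le_right _ _
  refine ⟨_, (((reach_three_mul v s A (i := 0) (k := 1) (by decide) (hm 0) (hm 1)).trans
    (reach_three_mul _ _ _ (i := 2) (k := 0) (by decide) (hm 2) (he' 0))).trans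
    (reach_three_mul _ _ _ (i := 1) (k := 2) (by decide) (he' 1)
      (he' 2))).congr_threeState rfl (fun _ => rfl) (fun x i => ?_) fun _ => rfl⟩
  rw [mul_assoc, mul_assoc, ← pow_add, ← pow_add, ← hadd i]
  fin_cases i <;> simp [hadd]

theorem PowersReachable.digit (hn : 1 ≤ n) {k M : ℕ} (h : PowersReachable d n k M) :
    PowersReachable d n (k + 2) (n * M) := by
  intro v s A e he
  have hm : ∀ l, e l % n ≤ n := fun l => (Nat.mod_lt _ hn).le
  obtain ⟨s', h⟩ := h v (fun x => s x ^ n) (fun x l => A x l * s x ^ (e l % n))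
    (fun l => e l / n) fun l => Nat.div_lt_of_lt_mul (he l)
  refine ⟨s', ((((reach_three_mul v s A (i := 0) (k := 1) (by decide) (hm 0) (hm 1)).trans
    (reach_three_mul_pow _ _ _ hn 2 (hm 2))).congr_threeState rfl (fun _ => rfl)
      (fun x i => ?_) fun _ => rfl).trans h).congr_threeState (by omega) (fun _ => rfl)
      (fun x i => ?_) fun _ => rfl⟩
  · fin_cases i <;> simp
  · rw [← pow_mul, mul_assoc, ← pow_add, Nat.mod_add_div]

theorem powersReachable_of_large (hn : 7 ≤ n) (T : ℕ) :
    PowersReachable d n (3 * (T + 1) + 2) ((n + 2) ^ (T + 2)) := by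
  have h1 : 1 ≤ n := by omega
  induction T using Nat.twoStepInduction with
  | zero =>
    refine (powersReachable_three.digit h1).mono ?_
    obtain ⟨m, rfl⟩ := Nat.exists_eq_add_of_le hn
    ring_nf
    nlinarith
  | one =>
    refine ((powersReachable_two.digit h1).digit h1 |>.digit h1).mono ?_
    obtain ⟨m, rfl⟩ := Nat.exists_eq_add_of_le hn
    ring_nf
    nlinarith [Nat.zero_le (m ^ 2), Nat.zero_le (m ^ 3), Nat.zero_le (m ^ 4)]
  | more T ih _ =>
    refine (((ih.digit h1).digit h1).digit h1).mono ?_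
    rw [show T + 2 + 2 = 2 + (T + 2) by omega, pow_add, ← mul_assoc, ← mul_assoc]
    refine Nat.mul_le_mul_right _ ?_
    nlinarith [Nat.mul_le_mul_left (n * n) hn]

theorem reach_three_monomials (hn : 1 ≤ n) {k M : ℕ} (hP : PowersReachable d n k M)
    (c : Fin 3 → ℝ) (e : Fin d → Fin 3 → ℕ) (he : ∀ j l, e j l < M) :
    ∃ A' s', Reach d (n + 2) (d * (k + 1) + 6) (threeState _ v A s)
      (threeState _ (fun x => v x + ∑ l, c l * ∏ j, x j ^ e j l) A' s') := by
  classical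
  have key : ∀ S : Finset (Fin d), ∃ s', Reach d (n + 2) (S.card * (k + 1))
      (threeState _ v (fun _ _ => 1) s)
      (threeState _ v (fun x l => ∏ j ∈ S, x j ^ e j l) s') := by
    intro S
    induction S using Finset.induction_on with
    | empty => exact ⟨_, by simpa using Reach.refl _⟩
    | insert j S hj ih =>
      obtain ⟨s', hS⟩ := ih
      obtain ⟨s'', h⟩ := hP v (fun x => x j) (fun x l => ∏ j ∈ S, x j ^ e j l) (e j) (he j)
      refine ⟨s'', ((hS.trans (reach_three_load _ _ _ hn j)).trans h).congr_threeState
        ?_ (fun _ => rfl) (fun x l => ?_) fun _ => rfl⟩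
      · rw [Finset.card_insert_of_notMem hj]
        ring
      · rw [Finset.prod_insert hj, mul_comm]
  obtain ⟨s', h⟩ := key Finset.univ
  have hinit := (((reach_three_set_one (n := n) v s A 0).trans (reach_three_set_one _ _ _ 1)).trans
    (reach_three_set_one _ _ _ 2)).congr_threeState (A' := fun _ _ => 1) rfl (fun _ => rfl)
    (fun x i => by fin_cases i <;> simp) fun _ => rfl
  exact ⟨_, _, ((((hinit.trans h).trans (reach_three_output _ _ _ (c 0) 0)).trans
    (reach_three_output _ _ _ (c 1) 1)).trans
    (reach_three_output _ _ _ (c 2) 2)).congr_threeState (by simp; omega)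
    (fun x => by rw [Fin.sum_univ_three]; ring) (fun _ _ => rfl) fun _ => rfl⟩

end ThreeAccumulators

theorem oneState_eq_threeState {q d : ℕ} (v A s : (Fin d → ℝ) → ℝ) :
    oneState q v A s = threeState q v (fun x => ![A x, s x, s x]) s := by
  funext x i
  simp only [oneState, threeState, slotState]
  generalize (i : ℕ) - (d + 1) = r
  rcases r with _ | _ | _ | r
  · simp
  · simp
  · simp
  · simp

section Polynomial

variable {d q : ℕ}

theorem zeroState_eq_oneState (v s : (Fin d → ℝ) → ℝ) :
    zeroState q v s = oneState q v s s := by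
  funext x i
  simp only [zeroState, oneState, slotState]
  generalize (i : ℕ) - (d + 1) = r
  rcases r with _ | r <;> simp

/-- Monomials that can be added to the output slot one at a time, while maintaining an invariant,
can be summed up. -/
theorem exists_reach_sum_of_monomial {B : ℕ} (Λ : Finset (Fin d → ℕ)) (C : (Fin d → ℕ) → ℝ)
    (Inv : ((Fin d → ℝ) → ℝ) → ((Fin d → ℝ) → Fin (d + 2 + q) → ℝ) → Prop)
    (hInv : ∀ v F, Inv v F → ∀ x, F x ⟨0, by omega⟩ = v x)
    (h0 : Inv (fun _ => 0) (oneState q (fun _ => 0) (fun _ => 0) fun _ => 0))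
    (hstep : ∀ α ∈ Λ, ∀ v F, Inv v F →
      ∃ k ≤ B, ∃ G, Reach d q k F G ∧ Inv (fun x => v x + C α * ∏ j, x j ^ α j) G) :
    ∃ k ≤ Λ.card * B, ∃ G,
      Reach d q k (oneState q (fun _ => 0) (fun _ => 0) fun _ => 0) G ∧
        ∀ x, G x ⟨0, by omega⟩ = ∑ α ∈ Λ, C α * ∏ j, x j ^ α j := by
  obtain ⟨k, hk, G, hG, hI⟩ := exists_reach_sum (g := 1) (B := B) Λ
    (fun α x => C α * ∏ j, x j ^ α j) Inv (fun S hS hcard v F hF => by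
      obtain ⟨α, rfl⟩ := Finset.card_eq_one.1 hcard
      simpa using hstep α (hS (Finset.mem_singleton_self α)) v F hF)
    Λ.card Λ subset_rfl (by simp) _ _ h0
  exact ⟨k, by simpa using hk, G, hG, fun x => by simpa using hInv _ _ hI x⟩

theorem exists_reach_sum_of_three {n : ℕ} (hn : 7 ≤ n) (hd : 1 ≤ d) (t : ℕ)
    (Λ : Finset (Fin d → ℕ)) (C : (Fin d → ℕ) → ℝ)
    (hΛ : ∀ α ∈ Λ, ∀ j, α j < (n + 2) ^ (t + 2)) :
    ∃ k ≤ Λ.card * (2 + d + d * (t + 1)), ∃ G,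
      Reach d (n + 2) k (oneState (n + 2) (fun _ => 0) (fun _ => 0) fun _ => 0) G ∧
        ∀ x, G x ⟨0, by omega⟩ = ∑ α ∈ Λ, C α * ∏ j, x j ^ α j := by
  classical
  obtain ⟨R, hRΛ, hR⟩ := Finset.exists_subset_card_eq (Nat.mod_le Λ.card 3)
  have hfirst : ∃ k ≤ R.card * (2 + d + d * (t + 1)), ∃ A s,
      Reach d (n + 2) k (oneState (n + 2) (fun _ => 0) (fun _ => 0) fun _ => 0)
        (oneState (n + 2) (fun x => ∑ α ∈ R, C α * ∏ j, x j ^ α j) A s) := by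
    have h3 : R.card < 3 := hR ▸ Nat.mod_lt _ (by omega)
    interval_cases h : R.card
    · obtain rfl := Finset.card_eq_zero.1 h
      exact ⟨0, by simp, _, _, by simpa using Reach.refl _⟩
    · obtain ⟨α, rfl⟩ := Finset.card_eq_one.1 h
      obtain ⟨A, s, hA⟩ := reach_first_monomial (q := n + 2) (by omega) hd t (C α) α
        (hΛ α (hRΛ (by simp)))
      refine ⟨_, ?_, A, s, by simpa using hA⟩
      linarith
    · obtain ⟨α, β, hαβ, rfl⟩ := Finset.card_eq_two.1 h
      obtain ⟨A, s, hA⟩ := reach_two_monomials (q := n + 2) (by omega) (t + 1) (C α) (C β) α β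
        (hΛ α (hRΛ (by simp))) (hΛ β (hRΛ (by simp)))
      refine ⟨_, ?_, A, s, by simpa [Finset.sum_pair hαβ] using hA⟩
      linarith
  obtain ⟨k, hk, A, s, hA⟩ := hfirst
  have hcard : (Λ \ R).card = 3 * (Λ.card / 3) := by
    rw [Finset.card_sdiff_of_subset hRΛ, hR]
    omega
  obtain ⟨k', hk', G, hG, A', s', rfl⟩ := exists_reach_sum (g := 3)
    (B := 2 + d + d * (t + 1)) (Λ \ R) (fun α x => C α * ∏ j, x j ^ α j)
    (fun v F => ∃ A s, F = threeState (n + 2) v A s) (fun S hS hcard v F hF => by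
      obtain ⟨A, s, rfl⟩ := hF
      obtain ⟨α, β, γ, hαβ, hαγ, hβγ, rfl⟩ := Finset.card_eq_three.1 hcard
      have hlt : ∀ δ ∈ ({α, β, γ} : Finset (Fin d → ℕ)), ∀ j, δ j < (n + 2) ^ (t + 2) :=
        fun δ hδ => hΛ δ (Finset.sdiff_subset (hS hδ))
      obtain ⟨A', s', h⟩ := reach_three_monomials v s A (by omega)
        (powersReachable_of_large hn t) ![C α, C β, C γ] (fun j => ![α j, β j, γ j])
        (fun j l => by fin_cases l <;> exact hlt _ (by simp) j)
      refine ⟨_, ?_, _, h, A', s', ?_⟩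
      · linarith
      congr 1
      funext x
      rw [Fin.sum_univ_three, Finset.sum_insert (by simp [hαβ, hαγ]), Finset.sum_pair hβγ]
      simp [add_assoc])
    (Λ.card / 3) (Λ \ R) subset_rfl hcard _ _ ⟨_, s, oneState_eq_threeState _ A s⟩
  refine ⟨k + k', ?_, _, hA.trans hG, fun x => ?_⟩
  · calc k + k' ≤ (R.card + 3 * (Λ.card / 3)) * (2 + d + d * (t + 1)) := by
          rw [add_mul]
          exact add_le_add hk hk'
      _ = Λ.card * (2 + d + d * (t + 1)) := by rw [hR, Nat.mod_add_div]
  · rw [← Finset.sum_sdiff hRΛ]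
    simp [threeState, slotState, add_comm]

theorem exists_reach_polynomial (hq : 2 ≤ q) (Λ : Finset (Fin d → ℕ)) (C : (Fin d → ℕ) → ℝ)
    {N : ℕ} (hN : ∀ α ∈ Λ, ∀ j, α j ≤ N) :
    ∃ k ≤ Λ.card * (2 + d + d * Nat.log q (N + 1)), ∃ G,
      Reach d q k (oneState q (fun _ => 0) (fun _ => 0) fun _ => 0) G ∧
        ∀ x, G x ⟨0, by omega⟩ = ∑ α ∈ Λ, C α * ∏ j, x j ^ α j := by
  have hlt : N + 1 < q ^ (Nat.log q (N + 1) + 1) := Nat.lt_pow_succ_log_self (by omega) _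
  generalize Nat.log q (N + 1) = T at hlt
  have hpow : ∀ α ∈ Λ, ∀ j, α j < q ^ (T + 1) := fun α hα j => by
    have := hN α hα j
    omega
  have hq1 : 1 ≤ q := by omega
  by_cases hle : ∀ α ∈ Λ, ∀ j, α j ≤ q
  · refine exists_reach_sum_of_monomial Λ C (fun v F => ∃ A s, F = oneState q v A s)
      (fun v F hF x => by obtain ⟨A, s, rfl⟩ := hF; simp [oneState, slotState]) ⟨_, _, rfl⟩
      fun α hα v F hF => ?_
    obtain ⟨A, s, rfl⟩ := hF
    obtain ⟨A', s', h⟩ := reach_monomial_of_le v A s hq1 (C α) α (hle α hα)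
    exact ⟨_, by omega, _, h, A', s', rfl⟩
  push Not at hle
  obtain ⟨α₀, hα₀, j₀, hj₀⟩ := hle
  have hd0 : 0 < d := j₀.pos
  obtain _ | t := T
  · have := hpow α₀ hα₀ j₀
    rw [zero_add, pow_one] at this
    omega
  by_cases hd : d < 3
  · refine exists_reach_sum_of_monomial Λ C (fun v F => ∃ A, F = oneState q v A fun _ => 0)
      (fun v F hF x => by obtain ⟨A, rfl⟩ := hF; simp [oneState, slotState]) ⟨_, rfl⟩
      fun α hα v F hF => ?_
    obtain ⟨A, rfl⟩ := hF
    interval_cases d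
    · obtain ⟨A', h⟩ := reach_monomial_fin_one hq1 (t + 1) v A (C α) α (hpow α hα)
      exact ⟨_, by omega, _, h, A', rfl⟩
    · obtain ⟨A', h⟩ := reach_monomial_fin_two hq1 (t + 1) v A (C α) α (hpow α hα)
      exact ⟨_, by omega, _, h, A', rfl⟩
  obtain hq8 | hq9 := le_or_gt q 8
  · refine exists_reach_sum_of_monomial Λ C (fun v F => ∃ s, F = zeroState q v s)
      (fun v F hF x => by obtain ⟨s, rfl⟩ := hF; simp [zeroState, slotState])
      ⟨_, (zeroState_eq_oneState _ _).symm⟩ fun α hα v F hF => ?_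
    obtain ⟨s, rfl⟩ := hF
    obtain ⟨s', h⟩ := reach_monomial_of_binary v s hq1 (3 * (t + 1 + 1)) (C α) α fun j => by
      rw [pow_mul]
      exact (hpow α hα j).trans_le (Nat.pow_le_pow_left hq8 _)
    refine ⟨_, ?_, _, h, s', rfl⟩
    nlinarith
  · obtain ⟨n, rfl⟩ := Nat.exists_eq_add_of_le' hq
    exact exists_reach_sum_of_three (by omega) (by omega) t Λ C hpow

end Polynomial

end CompositionalTensorTrain

/-- Encoding of a sparse multivariate polynomial as a compositional
tensor train of width p = d + 2 + q, with L ≤ |Λ|(2 + d + d⌊log_q(N_max + 1)⌋)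
layers, each layer a TT with affine factors and ranks bounded by (p, 2, …, 2, 1). -/
theorem stmt_7 (d q : ℕ) (hq : 2 ≤ q)
    (Λ : Finset (Fin d → ℕ)) (hΛ : Λ.Nonempty)
    (C : (Fin d → ℕ) → ℝ) (hC : ∀ α ∈ Λ, C α ≠ 0)
    (Nmax : ℕ) (hN : Nmax = Λ.sup fun α => Finset.univ.sup α) :
    ∃ L : ℕ, L ≤ Λ.card * (2 + d + d * Nat.log q (Nmax + 1)) ∧
      ∃ ψ : Fin L → (Fin (d + 2 + q) → ℝ) → Fin (d + 2 + q) → ℝ,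
        (∀ ℓ, HasTTAffine (d + 2 + q) (ψ ℓ) 2) ∧
        ∀ x : Fin d → ℝ,
          ((List.finRange L).foldl (fun y ℓ => y + ψ ℓ y)
              (fun i : Fin (d + 2 + q) =>
                if h : 1 ≤ (i : ℕ) ∧ (i : ℕ) ≤ d then x ⟨(i : ℕ) - 1, by omega⟩ else 0))
            ⟨0, by omega⟩
          = ∑ α ∈ Λ, C α * ∏ j, x j ^ α j := by
  obtain ⟨L, hL, G, ⟨l, rfl, hl, hG⟩, hG0⟩ := exists_reach_polynomial (N := Nmax) hq Λ C
    fun α hα j => hN ▸ (Finset.le_sup (f := α) (Finset.mem_univ j)).trans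
      (Finset.le_sup (f := fun α => Finset.univ.sup α) hα)
  refine ⟨_, hL, l.get, fun ℓ => hl _ (List.get_mem _ _), fun x => ?_⟩
  have hinit : (fun i : Fin (d + 2 + q) =>
      if h : 1 ≤ (i : ℕ) ∧ (i : ℕ) ≤ d then x ⟨(i : ℕ) - 1, by omega⟩ else 0) =
      oneState q (fun _ => 0) (fun _ => 0) (fun _ => 0) x := by
    funext i
    simp only [oneState, slotState]
    split_ifs <;> first | rfl | omega | simp
  rw [hinit, ← hG0, ← hG, ← List.foldl_map (f := l.get) (g := fun y ψ => y + ψ y),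
    ← List.ofFn_eq_map, List.ofFn_get]
end

section
/- Let σ : ℝ → ℝ, let d, d_o, L ∈ ℕ and p_f ≥ max(d, d_o) with p_f ≥ 2, and let f = T_L ∘ σ⃗ ∘ T_{L−1} ∘ σ⃗ ∘ ⋯ ∘ σ⃗ ∘ T₁ be a deep neural network, where T₁ : ℝ^d → ℝ^{p_f}, T_ℓ : ℝ^{p_f} → ℝ^{p_f} for 2 ≤ ℓ ≤ L−1, and T_L : ℝ^{p_f} → ℝ^{d_o} are affine maps, and σ⃗ denotes componentwise application of σ. Then there exist 2L−1 functions ψ₁, …, ψ_{2L−1} : ℝ^{p_f} → ℝ^{p_f}, each admitting a tensor-train representation with ranks bounded by (p_f, p_f, …, p_f, 1) and with every entry of the k-th matrix factor lying in span{1, x, σ(x)} as a function of the k-th variable, such that with the lift 𝔏(x) = (x₁, …, x_d, 0, …, 0) ∈ ℝ^{p_f} and the retraction 𝔑(y) = (y₁, …, y_{d_o}), one has f = 𝔑 ∘ (Id + ψ_{2L−1}) ∘ ⋯ ∘ (Id + ψ₁) ∘ 𝔏 on ℝ^d. -/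
/-- `ψ` admits a tensor-train representation with ranks bounded by `(p, …, p, 1)` whose `k`-th
factor has entries in `span {1, x, σ}` as functions of the `k`-th variable. -/
def HasTTRep (σ : ℝ → ℝ) {p : ℕ} (ψ : (Fin p → ℝ) → Fin p → ℝ) : Prop :=
  ∃ (r : Fin (p + 1) → ℕ) (h0 : r 0 = p),
    r (Fin.last p) = 1 ∧ (∀ k : Fin (p + 1), r k ≤ p) ∧
    ∃ U : ∀ i : Fin p, ℝ → Matrix (Fin (r i.castSucc)) (Fin (r i.succ)) ℝ,
      (∀ i a c, ∃ c0 c1 c2 : ℝ, ∀ t, U i t a c = c0 + c1 * t + c2 * σ t) ∧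
      ∀ y : Fin p → ℝ, ∀ (i : Fin (r 0)) (j : Fin (r (Fin.last p))),
        ttProd r (fun k => U k (y k)) i j = ψ y (Fin.cast h0 i)

/-- Entry `(a, c)` of the `k`-th tensor-train factor, evaluated where the `k`-th variable contributes
`s`, for the function `b + ∑ j, M j * s j`: column `0` carries the running sum, column `c`
the coefficient of a variable that has not been read yet. -/
def ttSumEntry (b : ℕ → ℝ) (M : ℕ → ℕ → ℝ) (k : ℕ) (s : ℝ) (a c : ℕ) : ℝ :=
  if k = 0 then (if c = 0 then b a + M a 0 * s else M a c)
  else if c = 0 then (if a = 0 then 1 else 0) + (if a = k then s else 0)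
  else if a = c then (if c = k then 0 else 1) else 0

/-- Entry `(i, c)` of the product of the first `k` matrices with entries `ttSumEntry`. -/
def ttSumPartial (b : ℕ → ℝ) (M : ℕ → ℕ → ℝ) (s : ℕ → ℝ) (k i c : ℕ) : ℝ :=
  if k = 0 then (if i = c then 1 else 0)
  else if c = 0 then b i + ∑ j ∈ Finset.range k, M i j * s j
  else if c < k then 0 else M i c

lemma sum_ttSumPartial_mul_ttSumEntry (b : ℕ → ℝ) (M : ℕ → ℕ → ℝ) (s : ℕ → ℝ) {p k i c : ℕ}
    (hk : k < p) (hi : i < p) (hc : c < p) :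
    ∑ a ∈ Finset.range p, ttSumPartial b M s k i a * ttSumEntry b M k (s k) a c =
      ttSumPartial b M s (k + 1) i c := by
  rcases Nat.eq_zero_or_pos k with rfl | hk0
  · simp [ttSumPartial, ttSumEntry, hi]
    grind
  · have hk' : k ≠ 0 := hk0.ne'
    have hp : 0 < p := by omega
    by_cases hc0 : c = 0
    · subst hc0
      simp [ttSumPartial, ttSumEntry, hk', mul_add, Finset.sum_add_distrib, hp, hk,
        Finset.sum_range_succ, add_assoc]
    · simp [ttSumPartial, ttSumEntry, hk', hc0, hc]
      grind

lemma ttProdAux_eq_ttSumPartial (b : ℕ → ℝ) (M : ℕ → ℕ → ℝ) {p : ℕ} (r : Fin (p + 1) → ℕ)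
    (hr : ∀ k, r k ≤ p) (hr' : ∀ k : Fin p, r k.castSucc = p) (s : ℕ → ℝ) (k : Fin (p + 1))
    (i : Fin (r 0)) (c : Fin (r k)) :
    ttProdAux r (fun k => Matrix.of fun a c => ttSumEntry b M k (s k) a c) k i c =
      ttSumPartial b M s k i c := by
  induction k using Fin.induction with
  | zero => simp [ttProdAux, ttSumPartial, Matrix.one_apply, Fin.ext_iff]
  | succ k ih =>
    have hstep : ttProdAux r (fun k => Matrix.of fun a c => ttSumEntry b M k (s k) a c) k.succ =
        ttProdAux r (fun k => Matrix.of fun a c => ttSumEntry b M k (s k) a c) k.castSucc *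
          Matrix.of fun (a : Fin (r k.castSucc)) (c : Fin (r k.succ)) =>
            ttSumEntry b M k (s k) a c := by
      simp [ttProdAux]
    rw [hstep, Matrix.mul_apply]
    simp only [ih, Matrix.of_apply, Fin.val_castSucc, Fin.val_succ]
    rw [Fin.sum_univ_eq_sum_range
      (fun a => ttSumPartial b M s k i a * ttSumEntry b M k (s k) a c), hr']
    exact sum_ttSumPartial_mul_ttSumEntry b M s k.isLt (i.isLt.trans_le (hr 0))
      (c.isLt.trans_le (hr _))

lemma hasTTRep_const_add_mulVec (σ : ℝ → ℝ) {p : ℕ} (hp : 2 ≤ p) (b : Fin p → ℝ)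
    (M : Matrix (Fin p) (Fin p) ℝ) (φ : ℝ → ℝ)
    (hφ : ∃ c0 c1 c2 : ℝ, ∀ t, φ t = c0 + c1 * t + c2 * σ t) :
    HasTTRep σ fun y => b + M.mulVec fun j => φ (y j) := by
  obtain ⟨e0, e1, e2, he⟩ := hφ
  set b' : ℕ → ℝ := fun i => if h : i < p then b ⟨i, h⟩ else 0 with hb'
  set M' : ℕ → ℕ → ℝ := fun i j => if h : i < p ∧ j < p then M ⟨i, h.1⟩ ⟨j, h.2⟩ else 0 with hM'
  set r : Fin (p + 1) → ℕ := fun k => if (k : ℕ) = p then 1 else p with hr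
  have hrle : ∀ k, r k ≤ p := fun k => by simp only [hr]; split_ifs <;> omega
  have hrc : ∀ k : Fin p, r k.castSucc = p := fun k => by simp [hr, k.isLt.ne]
  have h0 : r 0 = p := if_neg (by simp only [Fin.val_zero]; omega)
  refine ⟨r, h0, by simp [hr], hrle,
    fun k t => Matrix.of fun a c => ttSumEntry b' M' k (φ t) a c, ?_, ?_⟩
  · intro k a c
    have haff : ∃ u v : ℝ, ∀ s, ttSumEntry b' M' k s a c = u + v * s := by
      unfold ttSumEntry
      split_ifs
      exacts [⟨_, _, fun _ => rfl⟩, ⟨M' a c, 0, by simp⟩, ⟨1, 1, by simp⟩, ⟨1, 0, by simp⟩,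
        ⟨0, 1, by simp⟩, ⟨0, 0, by simp⟩, ⟨0, 0, by simp⟩, ⟨1, 0, by simp⟩, ⟨0, 0, by simp⟩]
    obtain ⟨u, v, huv⟩ := haff
    refine ⟨u + v * e0, v * e1, v * e2, fun t => ?_⟩
    simp only [Matrix.of_apply, huv, he]
    ring
  · intro y i j
    set s : ℕ → ℝ := fun k => if h : k < p then φ (y ⟨k, h⟩) else 0 with hs
    have hsy : ∀ k : Fin p, φ (y k) = s k := fun k => by simp [hs]
    have hj : (j : ℕ) = 0 := by
      have h1 : r (Fin.last p) = 1 := by simp [hr]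
      have := j.isLt
      omega
    have hi : (i : ℕ) < p := i.isLt.trans_le (hrle 0)
    have hp0 : p ≠ 0 := by omega
    simp only [hsy]
    rw [ttProd, ttProdAux_eq_ttSumPartial b' M' r hrle hrc s, hj]
    simp only [ttSumPartial, Fin.val_last, hp0, if_false, if_true]
    rw [← Fin.sum_univ_eq_sum_range (fun j => M' i j * s j)]
    simp [hb', hM', hi, Matrix.mulVec, dotProduct, hs, Fin.cast]

lemma hasTTRep_affine_sub_id (σ : ℝ → ℝ) {p : ℕ} (hp : 2 ≤ p) (b : Fin p → ℝ)
    (M : Matrix (Fin p) (Fin p) ℝ) :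
    HasTTRep σ fun y => M.mulVec y + b - y := by
  have h := hasTTRep_const_add_mulVec σ hp b (M - 1) id ⟨0, 1, 0, by simp⟩
  convert h using 2 with y
  simp only [id, Matrix.sub_mulVec, Matrix.one_mulVec]
  abel

lemma hasTTRep_comp_sub_id (σ : ℝ → ℝ) {p : ℕ} (hp : 2 ≤ p) :
    HasTTRep σ fun y : Fin p → ℝ => σ ∘ y - y := by
  have h := hasTTRep_const_add_mulVec (p := p) σ hp 0 1 (fun t => σ t - t)
    ⟨0, -1, 1, fun t => by ring⟩
  convert h using 2 with y
  ext i
  simp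

/-- The layers of a network that alternates the maps `A 0, A 1, …` with the map `S`. -/
def alternatingLayer {V : Type*} (A : ℕ → V → V) (S : V → V) (n : ℕ) : V → V :=
  if n % 2 = 0 then A (n / 2) else S

lemma foldl_range_alternatingLayer {V : Type*} (A : ℕ → V → V) (S : V → V) (x : V) (k : ℕ) :
    (List.range (2 * k + 2)).foldl (fun y n => alternatingLayer A S n y) x =
      (List.range k).foldl (fun y n => S (A (n + 1) y)) (S (A 0 x)) := by
  induction k with
  | zero => simp [List.range_succ, alternatingLayer]
  | succ k ih =>
    have h1 : (2 * k + 2) % 2 = 0 := by omega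
    have h2 : (2 * k + 2) / 2 = k + 1 := by omega
    have h3 : (2 * k + 2 + 1) % 2 ≠ 0 := by omega
    rw [show 2 * (k + 1) + 2 = 2 * k + 2 + 1 + 1 by ring, List.range_succ, List.range_succ,
      List.range_succ (n := k)]
    simp only [List.foldl_append, ih, List.foldl_cons, List.foldl_nil]
    simp only [alternatingLayer, h1, h2, h3, if_true, if_false]

lemma foldl_finRange_val {V : Type*} (g : V → ℕ → V) (n : ℕ) (x : V) :
    (List.finRange n).foldl (fun y (k : Fin n) => g y k) x = (List.range n).foldl g x := by
  rw [← List.map_coe_finRange_eq_range, List.foldl_map]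

/-- A deep neural network of constant width p_f ≥ max(d, d_o) with
affine layers and activation σ ∈ span Φ, Φ ⊇ {1, x, σ}, can be exactly encoded as a
compositional tensor train with 2L - 1 layers, each layer a TT whose ranks are
bounded by (p_f, …, p_f, 1) and whose k-th factor has entries in span{1, x, σ(x)}
as functions of the k-th variable. -/
theorem stmt_10 (σ : ℝ → ℝ) (d do_ L pf : ℕ)
    (hL : 2 ≤ L) (hpf : 2 ≤ pf) (hd : d ≤ pf) (hdo : do_ ≤ pf)
    (W1 : Matrix (Fin pf) (Fin d) ℝ) (b1 : Fin pf → ℝ)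
    (Wmid : Fin (L - 2) → Matrix (Fin pf) (Fin pf) ℝ)
    (bmid : Fin (L - 2) → Fin pf → ℝ)
    (WL : Matrix (Fin do_) (Fin pf) ℝ) (bL : Fin do_ → ℝ)
    (f : (Fin d → ℝ) → Fin do_ → ℝ)
    (hf : ∀ x, f x = WL.mulVec
        ((List.finRange (L - 2)).foldl
          (fun y k => fun i => σ (((Wmid k).mulVec y + bmid k) i))
          (fun i => σ ((W1.mulVec x + b1) i))) + bL) :
    ∃ ψ : Fin (2 * L - 1) → (Fin pf → ℝ) → Fin pf → ℝ,
      (∀ ℓ, ∃ (r : Fin (pf + 1) → ℕ) (h0 : r 0 = pf),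
        r (Fin.last pf) = 1 ∧ (∀ k : Fin (pf + 1), r k ≤ pf) ∧
        ∃ U : ∀ i : Fin pf, ℝ → Matrix (Fin (r i.castSucc)) (Fin (r i.succ)) ℝ,
          (∀ i a c, ∃ c0 c1 c2 : ℝ, ∀ t, U i t a c = c0 + c1 * t + c2 * σ t) ∧
          ∀ y : Fin pf → ℝ, ∀ (i : Fin (r 0)) (j : Fin (r (Fin.last pf))),
            ttProd r (fun k => U k (y k)) i j = ψ ℓ y (Fin.cast h0 i)) ∧
      ∀ x : Fin d → ℝ, f x = fun i : Fin do_ =>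
        ((List.finRange (2 * L - 1)).foldl (fun y ℓ => y + ψ ℓ y)
            (fun i : Fin pf => if h : (i : ℕ) < d then x ⟨(i : ℕ), h⟩ else 0))
          ⟨(i : ℕ), lt_of_lt_of_le i.isLt hdo⟩ := by
  obtain ⟨m, rfl⟩ : ∃ m, L = m + 2 := ⟨L - 2, by omega⟩
  change Fin m → Matrix (Fin pf) (Fin pf) ℝ at Wmid
  change Fin m → Fin pf → ℝ at bmid
  let M : ℕ → Matrix (Fin pf) (Fin pf) ℝ
    | 0 => Matrix.of fun i j => if h : (j : ℕ) < d then W1 i ⟨j, h⟩ else 0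
    | n + 1 => if h : n < m then Wmid ⟨n, h⟩ else
        Matrix.of fun i j => if h : (i : ℕ) < do_ then WL ⟨i, h⟩ j else 0
  let b : ℕ → Fin pf → ℝ
    | 0 => b1
    | n + 1 => if h : n < m then bmid ⟨n, h⟩ else
        fun i => if h : (i : ℕ) < do_ then bL ⟨i, h⟩ else 0
  let A : ℕ → (Fin pf → ℝ) → Fin pf → ℝ := fun n y => (M n).mulVec y + b n
  let S : (Fin pf → ℝ) → Fin pf → ℝ := fun y => σ ∘ y
  refine ⟨fun ℓ y => alternatingLayer A S ℓ y - y, fun ℓ => ?_, fun x => ?_⟩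
  · change HasTTRep σ fun y => alternatingLayer A S ℓ y - y
    unfold alternatingLayer
    split_ifs
    · exact hasTTRep_affine_sub_id σ hpf _ _
    · exact hasTTRep_comp_sub_id σ hpf
  · have hA0 : A 0 (fun i : Fin pf => if h : (i : ℕ) < d then x ⟨(i : ℕ), h⟩ else 0) =
        W1.mulVec x + b1 := by
      obtain ⟨e, rfl⟩ := Nat.exists_eq_add_of_le hd
      ext i
      simp [A, M, b, Matrix.mulVec, dotProduct, Fin.sum_univ_add]
    have hmid : ∀ (k : Fin m) y, A (k + 1) y = (Wmid k).mulVec y + bmid k := fun k y => by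
      simp [A, M, b]
    have hlast : ∀ y (i : Fin do_), A (m + 1) y ⟨i, i.isLt.trans_le hdo⟩ =
        (WL.mulVec y + bL) i := fun y i => by
      simp [A, M, b, Matrix.mulVec, dotProduct]
    ext i
    simp only [add_sub_cancel]
    rw [foldl_finRange_val (fun y n => alternatingLayer A S n y),
      show 2 * (m + 2) - 1 = 2 * m + 2 + 1 by omega, List.range_succ, List.foldl_append,
      foldl_range_alternatingLayer, hA0, ← foldl_finRange_val (fun y n => S (A (n + 1) y))]
    simp only [hmid, List.foldl_cons, List.foldl_nil]
    have h1 : (2 * m + 2) % 2 = 0 := by omega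
    have h2 : (2 * m + 2) / 2 = m + 1 := by omega
    simp only [alternatingLayer, h1, h2, if_true]
    rw [hlast, hf]
    rfl
end

section
/- Let p, m, L ∈ ℕ and let f : ℝ^p × ℝ^m → ℝ^p, ℒ_k : ℝ^p × ℝ^m → ℝ (k = 1, …, L), and g : ℝ^p → ℝ be continuously differentiable. Fix X₀ ∈ ℝ^p and, for controls u = (u₁, …, u_L) ∈ (ℝ^m)^L, define the states X_k = f(X_{k−1}, u_k) for k = 1, …, L, and the cost J(u) = Σ_{k=1}^L ℒ_k(X_{k−1}, u_k) + g(X_L). Define the costates backward by λ_L = ∇g(X_L) and λ_k = ∂_x ℒ_{k+1}(X_k, u_{k+1}) + (∂_x f(X_k, u_{k+1}))ᵀ λ_{k+1} for k = L−1, …, 1. Then for every k, the gradient of J with respect to u_k equals the partial gradient of the Hamiltonian: ∇_{u_k} J(u) = ∂_u ℒ_k(X_{k−1}, u_k) + (∂_u f(X_{k−1}, u_k))ᵀ λ_k = ∂_u H_k(X_{k−1}, u_k, λ_k), where H_k(x, u, λ) = ℒ_k(x, u) + ⟨λ, f(x, u)⟩. In particular, if u* is a local minimizer of J, then ∂_u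 H_k(X*_{k−1}, u*_k, λ*_k) = 0 for all k, which is the first-order necessary condition of the discrete Pontryagin maximum principle. -/
open scoped RealInnerProductSpace

/-- State trajectory: `traj f X0 u k = X_k` with `X_0 = X0` and
`X_k = f (X_{k-1}, u_k)`. -/
noncomputable def traj {E U : Type*} (f : E × U → E) (X0 : E) (u : ℕ → U) : ℕ → E
  | 0 => X0
  | k + 1 => f (traj f X0 u k, u (k + 1))

/-- Chain rule for gradients: the gradient of `ℓ + φ ∘ F` is `∇ℓ + (DF)ᵀ ∇φ`. -/
theorem hasGradientAt_add_comp {E V : Type*}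
    [NormedAddCommGroup E] [InnerProductSpace ℝ E] [CompleteSpace E]
    [NormedAddCommGroup V] [InnerProductSpace ℝ V] [CompleteSpace V]
    {ℓ : V → ℝ} {φ : E → ℝ} {F : V → E} {x : V} {l : E}
    (hℓ : DifferentiableAt ℝ ℓ x) (hF : DifferentiableAt ℝ F x)
    (hφ : HasGradientAt φ l (F x)) :
    HasGradientAt (fun y => ℓ y + φ (F y))
      (gradient ℓ x + ContinuousLinearMap.adjoint (fderiv ℝ F x) l) x := by
  rw [hasGradientAt_iff_hasFDerivAt]
  refine (hℓ.hasGradientAt.hasFDerivAt.add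
    (hφ.hasFDerivAt.comp x hF.hasFDerivAt)).congr_fderiv ?_
  ext h
  simp [ContinuousLinearMap.adjoint_inner_left]

/-- A linear functional `⟪l, ·⟫` has gradient `l`. -/
theorem hasGradientAt_inner_left {E : Type*}
    [NormedAddCommGroup E] [InnerProductSpace ℝ E] [CompleteSpace E] (l x : E) :
    HasGradientAt (fun y => ⟪l, y⟫) l x := by
  rw [hasGradientAt_iff_hasFDerivAt]
  exact (InnerProductSpace.toDual ℝ E l).hasFDerivAt

/-- Cost incurred over the `n` stages after time `j`, starting from state `x`. -/
noncomputable def costToGo {E U : Type*} (f : E × U → E) (ℓ : ℕ → E × U → ℝ) (g : E → ℝ)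
    (u : ℕ → U) : ℕ → ℕ → E → ℝ
  | 0, _, x => g x
  | n + 1, j, x => ℓ (j + 1) (x, u (j + 1)) + costToGo f ℓ g u n (j + 1) (f (x, u (j + 1)))

theorem costToGo_congr {E U : Type*} (f : E × U → E) (ℓ : ℕ → E × U → ℝ) (g : E → ℝ)
    {u v : ℕ → U} (n j : ℕ) (h : ∀ i, j < i → u i = v i) :
    costToGo f ℓ g u n j = costToGo f ℓ g v n j := by
  induction n generalizing j with
  | zero => rfl
  | succ n ih =>
    funext x
    simp only [costToGo, h (j + 1) j.lt_succ_self, ih (j + 1) fun i hi => h i (by omega)]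

theorem traj_congr {E U : Type*} (f : E × U → E) (X0 : E) {u v : ℕ → U} (j : ℕ)
    (h : ∀ i, i ≤ j → u i = v i) : traj f X0 u j = traj f X0 v j := by
  induction j with
  | zero => rfl
  | succ j ih => simp only [traj, h (j + 1) le_rfl, ih fun i hi => h i (by omega)]

theorem sum_add_costToGo_traj {E U : Type*} (f : E × U → E) (ℓ : ℕ → E × U → ℝ) (g : E → ℝ)
    (X0 : E) (u : ℕ → U) (n j : ℕ) :
    (∑ k ∈ Finset.Icc 1 (j + n), ℓ k (traj f X0 u (k - 1), u k)) + g (traj f X0 u (j + n)) =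
      (∑ k ∈ Finset.Icc 1 j, ℓ k (traj f X0 u (k - 1), u k)) +
        costToGo f ℓ g u n j (traj f X0 u j) := by
  induction n generalizing j with
  | zero => rfl
  | succ n ih =>
    rw [show j + (n + 1) = j + 1 + n by omega, ih (j + 1),
      Finset.sum_Icc_succ_top (by omega), add_assoc]
    rfl

/-- The costates are the gradients of the cost-to-go along the trajectory. -/
theorem hasGradientAt_costToGo {E U : Type*}
    [NormedAddCommGroup E] [InnerProductSpace ℝ E] [CompleteSpace E]
    [NormedAddCommGroup U] [NormedSpace ℝ U]
    {f : E × U → E} {ℓ : ℕ → E × U → ℝ} {g : E → ℝ}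
    (hf : Differentiable ℝ f) (hℓ : ∀ k, Differentiable ℝ (ℓ k)) (hg : Differentiable ℝ g)
    (X0 : E) (u : ℕ → U) (lam : ℕ → E) (n j : ℕ)
    (hlast : lam (j + n) = gradient g (traj f X0 u (j + n)))
    (hlam : ∀ k, j ≤ k → k < j + n →
      lam k = gradient (fun x => ℓ (k + 1) (x, u (k + 1))) (traj f X0 u k) +
        ContinuousLinearMap.adjoint
          (fderiv ℝ (fun x => f (x, u (k + 1))) (traj f X0 u k)) (lam (k + 1))) :
    HasGradientAt (costToGo f ℓ g u n j) (lam j) (traj f X0 u j) := by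
  induction n generalizing j with
  | zero =>
    rw [add_zero] at hlast
    rw [hlast]
    exact (hg _).hasGradientAt
  | succ n ih =>
    rw [hlam j le_rfl (by omega)]
    refine hasGradientAt_add_comp (φ := costToGo f ℓ g u n (j + 1))
      (F := fun x => f (x, u (j + 1))) ?_ ?_ (ih (j + 1) ?_ ?_)
    · exact ((hℓ (j + 1)).comp (differentiable_id.prodMk (differentiable_const _))) _
    · exact (hf.comp (differentiable_id.prodMk (differentiable_const _))) _
    · rwa [show j + 1 + n = j + (n + 1) by omega]
    · exact fun k hk hk' => hlam k (by omega) (by omega)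

/-- Discrete Pontryagin maximum principle. For the cost
J(u) = Σ_{k=1}^L ℒ_k(X_{k-1}, u_k) + g(X_L) with dynamics X_k = f(X_{k-1}, u_k) and
costates λ_L = ∇g(X_L), λ_k = ∂ₓℒ_{k+1}(X_k, u_{k+1}) + (∂ₓf(X_k, u_{k+1}))ᵀλ_{k+1},
the gradient of J with respect to u_k equals the partial gradient of the Hamiltonian
H_k(x, u, λ) = ℒ_k(x, u) + ⟨λ, f(x, u)⟩ in u; in particular at a local minimizer
these partial gradients vanish. -/
theorem stmt_17 (p m L : ℕ) (hL : 1 ≤ L)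
    (f : EuclideanSpace ℝ (Fin p) × EuclideanSpace ℝ (Fin m) → EuclideanSpace ℝ (Fin p))
    (Lc : ℕ → EuclideanSpace ℝ (Fin p) × EuclideanSpace ℝ (Fin m) → ℝ)
    (g : EuclideanSpace ℝ (Fin p) → ℝ)
    (hf : ContDiff ℝ 1 f) (hLc : ∀ k, ContDiff ℝ 1 (Lc k)) (hg : ContDiff ℝ 1 g)
    (X0 : EuclideanSpace ℝ (Fin p))
    (J : (ℕ → EuclideanSpace ℝ (Fin m)) → ℝ)
    (hJ : ∀ u, J u =
      (∑ k ∈ Finset.Icc 1 L, Lc k (traj f X0 u (k - 1), u k)) + g (traj f X0 u L))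
    (u : ℕ → EuclideanSpace ℝ (Fin m))
    (lam : ℕ → EuclideanSpace ℝ (Fin p))
    (hlamL : lam L = gradient g (traj f X0 u L))
    (hlam : ∀ k, 1 ≤ k → k ≤ L - 1 →
      lam k = gradient (fun x => Lc (k + 1) (x, u (k + 1))) (traj f X0 u k) +
        ContinuousLinearMap.adjoint
          (fderiv ℝ (fun x => f (x, u (k + 1))) (traj f X0 u k)) (lam (k + 1))) :
    (∀ k, 1 ≤ k → k ≤ L →
      gradient (fun w => J (Function.update u k w)) (u k) =
        gradient (fun w => Lc k (traj f X0 u (k - 1), w)) (u k) +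
          ContinuousLinearMap.adjoint
            (fderiv ℝ (fun w => f (traj f X0 u (k - 1), w)) (u k)) (lam k) ∧
      gradient (fun w => J (Function.update u k w)) (u k) =
        gradient (fun w =>
          Lc k (traj f X0 u (k - 1), w) + ⟪lam k, f (traj f X0 u (k - 1), w)⟫) (u k)) ∧
    (IsLocalMin J u → ∀ k, 1 ≤ k → k ≤ L →
      gradient (fun w =>
        Lc k (traj f X0 u (k - 1), w) + ⟪lam k, f (traj f X0 u (k - 1), w)⟫) (u k) = 0) := by
  have hf' := hf.differentiable one_ne_zero
  have hLc' := fun k => (hLc k).differentiable one_ne_zero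
  have hfw (x : EuclideanSpace ℝ (Fin p)) : Differentiable ℝ fun w => f (x, w) :=
    hf'.comp ((differentiable_const x).prodMk differentiable_id)
  have hLcw (k : ℕ) (x : EuclideanSpace ℝ (Fin p)) : Differentiable ℝ fun w => Lc k (x, w) :=
    (hLc' k).comp ((differentiable_const x).prodMk differentiable_id)
  have hH (k : ℕ) : HasGradientAt (fun w =>
      Lc k (traj f X0 u (k - 1), w) + ⟪lam k, f (traj f X0 u (k - 1), w)⟫)
      (gradient (fun w => Lc k (traj f X0 u (k - 1), w)) (u k) +
        ContinuousLinearMap.adjoint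
          (fderiv ℝ (fun w => f (traj f X0 u (k - 1), w)) (u k)) (lam k)) (u k) :=
    hasGradientAt_add_comp (hLcw _ _ _) (hfw _ _) (hasGradientAt_inner_left _ _)
  have hgradJ (k : ℕ) (hk : 1 ≤ k) (hkL : k ≤ L) :
      HasGradientAt (fun w => J (Function.update u k w))
        (gradient (fun w => Lc k (traj f X0 u (k - 1), w)) (u k) +
          ContinuousLinearMap.adjoint
            (fderiv ℝ (fun w => f (traj f X0 u (k - 1), w)) (u k)) (lam k)) (u k) := by
    obtain ⟨j, rfl⟩ : ∃ j, k = j + 1 := ⟨k - 1, by omega⟩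
    obtain ⟨n, rfl⟩ : ∃ n, L = j + 1 + n := ⟨L - (j + 1), by omega⟩
    have hupd (w : EuclideanSpace ℝ (Fin m)) (i : ℕ) (hi : i ≠ j + 1) :
        Function.update u (j + 1) w i = u i := Function.update_of_ne hi _ _
    have htraj (w : EuclideanSpace ℝ (Fin m)) (i : ℕ) (hi : i ≤ j) :
        traj f X0 (Function.update u (j + 1) w) i = traj f X0 u i :=
      traj_congr f X0 i fun i' hi' => hupd w i' (by omega)
    have hJw : (fun w => J (Function.update u (j + 1) w)) = fun w =>
        ((∑ i ∈ Finset.Icc 1 j, Lc i (traj f X0 u (i - 1), u i)) +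
          Lc (j + 1) (traj f X0 u j, w)) +
          costToGo f Lc g u n (j + 1) (f (traj f X0 u j, w)) := by
      funext w
      rw [hJ, sum_add_costToGo_traj, Finset.sum_Icc_succ_top (by omega),
        costToGo_congr f Lc g n (j + 1) fun i hi => hupd w i (by omega)]
      simp only [traj, add_tsub_cancel_right, Function.update_self, htraj w j le_rfl]
      congr 2
      refine Finset.sum_congr rfl fun i hi => ?_
      rw [Finset.mem_Icc] at hi
      rw [htraj w _ (by omega), hupd w i (by omega)]
    have hV : HasGradientAt (costToGo f Lc g u n (j + 1)) (lam (j + 1))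
        (f (traj f X0 u j, u (j + 1))) :=
      hasGradientAt_costToGo hf' hLc' (hg.differentiable one_ne_zero) X0 u lam n (j + 1) hlamL
        fun k hk hk' => hlam k (by omega) (by omega)
    have hconst := hasGradientAt_add_comp (F := fun w => f (traj f X0 u j, w))
      ((hLcw (j + 1) (traj f X0 u j) (u (j + 1))).const_add
        (∑ i ∈ Finset.Icc 1 j, Lc i (traj f X0 u (i - 1), u i))) (hfw _ _) hV
    rw [hJw]
    simpa only [gradient, fderiv_const_add, add_tsub_cancel_right] using hconst
  refine ⟨fun k hk hkL => ⟨(hgradJ k hk hkL).gradient,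
    (hgradJ k hk hkL).gradient.trans (hH k).gradient.symm⟩, fun hmin k hk hkL => ?_⟩
  have hminw : IsLocalMin (fun w => J (Function.update u k w)) (u k) := by
    have hcont : ContinuousAt (fun w => Function.update u k w) (u k) := by fun_prop
    have hmin' : IsLocalMin J (Function.update u k (u k)) := by rwa [Function.update_eq_self]
    exact hcont.tendsto.eventually hmin'
  rw [(hH k).gradient, ← (hgradJ k hk hkL).gradient, gradient, hminw.fderiv_eq_zero, map_zero]
end
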